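/- arXiv:1812.03207 — 2 statements merged into one kernel-verified Lean document; each statement's English description precedes it below -/
import Mathlib

section
/- Let n ≥ 2, let k be an integer with n/2 < k ≤ n and k ≥ 2, and let d > 0. There exists a constant C > 0, depending only on n, k and d, such that for every bounded open set Ω ⊆ ℝⁿ with diam(Ω) ≤ d and every solution θ of problem (★) on Ω, one has sup_Ω |θ| ≤ C · (vol(Ω)/(k−1))^{1/(k−1)}, where vol(Ω) denotes the Lebesgue measure of Ω. -/
open scoped BigOperators
open Metric Set MeasureTheory Filter

noncomputable section

/-- The Hessian matrix of a real-valued function `u` at the point `x`,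
whose `(i,j)` entry is `∂²u/∂xᵢ∂xⱼ (x)`. -/
def hessianMatrix (n : ℕ) (u : EuclideanSpace ℝ (Fin n) → ℝ)
    (x : EuclideanSpace ℝ (Fin n)) : Matrix (Fin n) (Fin n) ℝ :=
  Matrix.of fun i j =>
    iteratedFDeriv ℝ 2 u x ![EuclideanSpace.single i (1 : ℝ), EuclideanSpace.single j (1 : ℝ)]

/-- Sum of all `k × k` principal minors of an `n × n` matrix; for a symmetric matrix this
is the `k`-th elementary symmetric function of its eigenvalues. -/
def sumPrincipalMinors (n k : ℕ) (A : Matrix (Fin n) (Fin n) ℝ) : ℝ :=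
  ∑ s ∈ (Finset.univ : Finset (Fin n)).powersetCard k,
    (A.submatrix (fun i : {i // i ∈ s} => (i : Fin n))
      (fun i : {i // i ∈ s} => (i : Fin n))).det

/-- The `k`-Hessian operator `S_k(D²u)(x)`. -/
def SkHess (n k : ℕ) (u : EuclideanSpace ℝ (Fin n) → ℝ)
    (x : EuclideanSpace ℝ (Fin n)) : ℝ :=
  sumPrincipalMinors n k (hessianMatrix n u x)

/-- `u` is `k`-admissible on the bounded open set `Ω`:
`u ∈ C²(Ω) ∩ C(Ω̄)` and `S_j(D²u) > 0` in `Ω` for every `j = 1, …, k`. -/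
def KAdmissible (n k : ℕ) (Ω : Set (EuclideanSpace ℝ (Fin n)))
    (u : EuclideanSpace ℝ (Fin n) → ℝ) : Prop :=
  ContDiffOn ℝ 2 u Ω ∧ ContinuousOn u (closure Ω) ∧
    ∀ j, 1 ≤ j → j ≤ k → ∀ x ∈ Ω, 0 < SkHess n j u x

/-- `θ` is a solution of problem (★) on `Ω`:
`θ` is `k`-admissible, `θ < 0` in `Ω`, `θ = 0` on `∂Ω` and `S_k(D²θ) = -θ/(k-1)` in `Ω`. -/
def IsStarSolution (n k : ℕ) (Ω : Set (EuclideanSpace ℝ (Fin n)))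
    (θ : EuclideanSpace ℝ (Fin n) → ℝ) : Prop :=
  KAdmissible n k Ω θ ∧ (∀ x ∈ Ω, θ x < 0) ∧ (∀ x ∈ frontier Ω, θ x = 0) ∧
    ∀ x ∈ Ω, SkHess n k θ x = -θ x / ((k : ℝ) - 1)

/-- `u : [0,∞) × Ω̄ → ℝ` is a classical solution of problem (P):
`∂ₜu = S_k(D²u)` in `(0,∞) × Ω`, `u(t,·)` is `k`-admissible for each `t ≥ 0`,
and `u = 0` on `[0,∞) × ∂Ω`. -/
def IsSolutionP (n k : ℕ) (Ω : Set (EuclideanSpace ℝ (Fin n)))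
    (u : ℝ → EuclideanSpace ℝ (Fin n) → ℝ) : Prop :=
  (∀ t : ℝ, 0 < t → ∀ x ∈ Ω, HasDerivAt (fun s => u s x) (SkHess n k (u t) x) t) ∧
    (∀ t : ℝ, 0 ≤ t → KAdmissible n k Ω (u t)) ∧
    (∀ t : ℝ, 0 ≤ t → ∀ x ∈ frontier Ω, u t x = 0)

/-- `sup_Ω |θ|`. -/
def supAbs (n : ℕ) (Ω : Set (EuclideanSpace ℝ (Fin n)))
    (θ : EuclideanSpace ℝ (Fin n) → ℝ) : ℝ :=
  sSup ((fun x => |θ x|) '' Ω)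


/-- Sum of principal minors over an arbitrary commutative ring. -/
def sgm {R : Type*} [CommRing R] (n k : ℕ) (A : Matrix (Fin n) (Fin n) R) : R :=
  ∑ s ∈ (Finset.univ : Finset (Fin n)).powersetCard k,
    (A.submatrix (fun i : {i // i ∈ s} => (i : Fin n))
      (fun i : {i // i ∈ s} => (i : Fin n))).det

theorem sgm_real (n k : ℕ) (A : Matrix (Fin n) (Fin n) ℝ) :
    sumPrincipalMinors n k A = sgm n k A := rfl

theorem sgm_smul {R : Type*} [CommRing R] (n k : ℕ) (c : R) (A : Matrix (Fin n) (Fin n) R) :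
    sgm n k (c • A) = c ^ k * sgm n k A := by
  unfold sgm
  rw [Finset.mul_sum]
  refine Finset.sum_congr rfl fun s hs => ?_
  rw [Finset.mem_powersetCard] at hs
  have : (c • A).submatrix (fun i : {i // i ∈ s} => (i : Fin n))
      (fun i : {i // i ∈ s} => (i : Fin n)) = c • (A.submatrix (fun i : {i // i ∈ s} => (i : Fin n))
      (fun i : {i // i ∈ s} => (i : Fin n))) := rfl
  rw [this, Matrix.det_smul, Fintype.card_coe, hs.2]

theorem sgm_map {R S : Type*} [CommRing R] [CommRing S] (f : R →+* S) (n k : ℕ)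
    (A : Matrix (Fin n) (Fin n) R) : f (sgm n k A) = sgm n k (A.map f) := by
  unfold sgm
  rw [map_sum]
  refine Finset.sum_congr rfl fun s hs => ?_
  rw [RingHom.map_det]
  rfl

theorem sgm_continuous {R : Type*} [CommRing R] [TopologicalSpace R] [IsTopologicalRing R]
    (n k : ℕ) : Continuous (sgm n k : Matrix (Fin n) (Fin n) R → R) := by
  unfold sgm
  refine continuous_finsetSum _ fun s _ => ?_
  exact (continuous_id.matrix_submatrix _ _).matrix_det

theorem sgm_poly {R : Type*} [CommRing R] (n k : ℕ) (A B : Matrix (Fin n) (Fin n) R) :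
    ∃ q : Polynomial R, (∀ t, q.eval t = sgm n k (t • A + B)) ∧ q.natDegree ≤ k ∧
      q.coeff k = sgm n k A := by
  refine ⟨∑ s ∈ (Finset.univ : Finset (Fin n)).powersetCard k,
    (((Polynomial.X : Polynomial R) • (A.submatrix (fun i : {i // i ∈ s} => (i : Fin n)) (fun i : {i // i ∈ s} => (i : Fin n))).map Polynomial.C
      + (B.submatrix (fun i : {i // i ∈ s} => (i : Fin n)) (fun i : {i // i ∈ s} => (i : Fin n))).map Polynomial.C).det), ?_, ?_, ?_⟩
  · intro t
    rw [Polynomial.eval_finsetSum]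
    unfold sgm
    refine Finset.sum_congr rfl fun s hs => ?_
    rw [← Polynomial.coe_evalRingHom, RingHom.map_det]
    congr 1
    ext i j
    simp; ring
  · refine Polynomial.natDegree_sum_le_of_forall_le _ _ fun s hs => ?_
    rw [Finset.mem_powersetCard] at hs
    refine (Polynomial.natDegree_det_X_add_C_le _ _).trans ?_
    rw [Fintype.card_coe, hs.2]
  · rw [Polynomial.finsetSum_coeff]
    unfold sgm
    refine Finset.sum_congr rfl fun s hs => ?_
    rw [Finset.mem_powersetCard] at hs
    have := Polynomial.coeff_det_X_add_C_card (A.submatrix (fun i : {i // i ∈ s} => (i : Fin n)) (fun i : {i // i ∈ s} => (i : Fin n))) (B.submatrix (fun i : {i // i ∈ s} => (i : Fin n)) (fun i : {i // i ∈ s} => (i : Fin n)))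
    rw [Fintype.card_coe, hs.2] at this
    exact this

theorem sgm_charpoly {R : Type*} [CommRing R] (n k : ℕ) (hk : k ≤ n)
    (A : Matrix (Fin n) (Fin n) R) : sgm n k A = (-A).charpoly.coeff (n - k) := by
  have := Matrix.charpoly_coeff_eq_sum_minors (-A) k (by simpa using hk)
  rw [Fintype.card_fin] at this
  rw [this]
  have h2 := sgm_smul n k (-1) A
  rw [neg_one_smul] at h2
  change _ = (-1) ^ k * sgm n k (-A)
  rw [h2, ← mul_assoc, ← mul_pow]; simp

theorem sgm_shift {K : Type*} [Field K] [Infinite K] (n k : ℕ) (hk : k ≤ n)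
    (A : Matrix (Fin n) (Fin n) K) (z : K) :
    sgm n k (A + z • 1) = (Polynomial.hasseDeriv (n - k) (-A).charpoly).eval z := by
  rw [sgm_charpoly n k hk, ← Polynomial.taylor_coeff]
  congr 1
  apply Polynomial.funext
  intro t
  rw [Polynomial.taylor_eval, Matrix.eval_charpoly, Matrix.eval_charpoly]
  congr 1
  ext i j
  by_cases h : i = j
  · subst h; simp; ring
  · simp [h]

/-- Gårding cone. -/
def Gam (n k : ℕ) (A : Matrix (Fin n) (Fin n) ℝ) : Prop :=
  A.IsSymm ∧ ∀ j, 1 ≤ j → j ≤ k → 0 < sgm n j A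

theorem sgm_zero {R : Type*} [CommRing R] (n : ℕ) (A : Matrix (Fin n) (Fin n) R) :
    sgm n 0 A = 1 := by
  simp [sgm]

theorem Gam.shift_pos {n k : ℕ} (hk : k ≤ n) {A : Matrix (Fin n) (Fin n) ℝ} (hA : Gam n k A)
    {t : ℝ} (ht : 0 ≤ t) : 0 < sgm n k (A + t • 1) := by
  rw [sgm_shift n k hk, Polynomial.eval_eq_sum_range' (n := k + 1)]
  · have hpos : ∀ i ∈ Finset.range (k+1), 0 < (Polynomial.hasseDeriv (n - k) (-A).charpoly).coeff i := by
      intro i hi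
      rw [Finset.mem_range] at hi
      rw [Polynomial.hasseDeriv_coeff]
      have h1 : i + (n - k) = n - (k - i) := by omega
      have h2 : 0 < (-A).charpoly.coeff (n - (k - i)) := by
        rw [← sgm_charpoly n (k - i) (by omega)]
        rcases Nat.eq_zero_or_pos (k - i) with h | h
        · rw [h, sgm_zero]; exact one_pos
        · exact hA.2 _ h (by omega)
      rw [← h1] at h2
      have h3 : 0 < (i + (n - k)).choose (n - k) := Nat.choose_pos (by omega)
      positivity
    have h0 := hpos 0 (by simp)
    rw [Finset.sum_range_succ']
    have : 0 ≤ ∑ i ∈ Finset.range k, (Polynomial.hasseDeriv (n - k) (-A).charpoly).coeff (i+1) * t ^ (i+1) :=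
      Finset.sum_nonneg fun i hi => mul_nonneg (hpos _ (by simpa using hi)).le (by positivity)
    simp only [pow_zero, mul_one]
    linarith
  · have := Polynomial.natDegree_hasseDeriv_le (-A).charpoly (n - k)
    rw [Matrix.charpoly_natDegree_eq_dim, Fintype.card_fin] at this
    omega

theorem realroot_iter (P : Polynomial ℂ) (hP : ∀ z, P.eval z = 0 → z.im = 0) (m : ℕ)
    (hm : m ≤ P.natDegree) (hP0 : P ≠ 0) : ((Polynomial.derivative)^[m] P ≠ 0) ∧
      ((Polynomial.derivative)^[m] P).natDegree = P.natDegree - m ∧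
      ∀ z, ((Polynomial.derivative)^[m] P).eval z = 0 → z.im = 0 := by
  induction m with
  | zero => exact ⟨hP0, rfl, hP⟩
  | succ m ih =>
    obtain ⟨h1, h2, h3⟩ := ih (by omega)
    rw [Function.iterate_succ_apply']
    set Q := (Polynomial.derivative)^[m] P
    have hd : Q.natDegree ≠ 0 := by omega
    have hdd : 0 < Q.degree := Polynomial.natDegree_pos_iff_degree_pos.mp (by omega)
    have hdeg := Polynomial.degree_derivative hd
    have hne : Polynomial.derivative Q ≠ 0 := by
      intro h; rw [h] at hdeg; simp at hdeg
    refine ⟨hne, ?_, ?_⟩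
    · rw [Polynomial.natDegree_eq_of_degree_eq_some hdeg]; omega
    · intro z hz
      have hz' : z ∈ (Polynomial.derivative Q).rootSet ℂ := by
        rw [Polynomial.mem_rootSet]; exact ⟨hne, by simpa using hz⟩
      have := Polynomial.rootSet_derivative_subset_convexHull_rootSet hdd hz'
      have hsub : convexHull ℝ (Q.rootSet ℂ) ⊆ {z : ℂ | z.im = 0} := by
        apply convexHull_min
        · intro w hw
          rw [Polynomial.mem_rootSet] at hw
          exact h3 w (by simpa using hw.2)
        · exact convex_hyperplane (f := Complex.im) ⟨Complex.add_im, by simp⟩ 0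
      exact hsub this

theorem sgm_hyp {n k : ℕ} (hk : k ≤ n) {A : Matrix (Fin n) (Fin n) ℝ} (hA : A.IsSymm) {z : ℂ}
    (hz : sgm n k (A.map (Complex.ofRealHom) + z • 1) = 0) : z.im = 0 := by
  rw [sgm_shift n k hk] at hz
  have hH : (-(A.map Complex.ofRealHom)).IsHermitian := by
    ext i j
    simp [Matrix.conjTranspose_apply, hA.apply]
  set P := (-(A.map Complex.ofRealHom)).charpoly with hPdef
  have hroots : ∀ z, P.eval z = 0 → z.im = 0 := by
    intro z hz
    rw [hPdef, hH.charpoly_eq, Polynomial.eval_prod, Finset.prod_eq_zero_iff] at hz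
    obtain ⟨i, _, hi⟩ := hz
    simp [sub_eq_zero] at hi
    rw [hi]; simp
  have hdeg : P.natDegree = n := by rw [hPdef, Matrix.charpoly_natDegree_eq_dim, Fintype.card_fin]
  have hne : P ≠ 0 := (Matrix.charpoly_monic _).ne_zero
  refine (realroot_iter P hroots (n - k) (by omega) hne).2.2 z ?_
  rw [← Polynomial.factorial_smul_hasseDeriv]
  simp [hz]


theorem poly_lower {k : ℕ} (q : Polynomial ℂ) (hdeg : q.natDegree ≤ k) (hc : q.coeff k ≠ 0)
    {z : ℂ} {δ : ℝ} (hδ : 0 ≤ δ) (hr : ∀ w, q.eval w = 0 → δ ≤ ‖z - w‖) :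
    ‖q.coeff k‖ * δ ^ k ≤ ‖q.eval z‖ := by
  have hk : q.natDegree = k := le_antisymm hdeg (Polynomial.le_natDegree_of_ne_zero hc)
  have hs := IsAlgClosed.splits q
  have h1 := hs.eq_prod_roots
  have hlc : q.leadingCoeff = q.coeff k := by rw [Polynomial.leadingCoeff, hk]
  have h2 : ‖q.eval z‖ = ‖q.coeff k‖ * (q.roots.map (fun w => ‖z - w‖)).prod := by
    conv_lhs => rw [h1]
    rw [Polynomial.eval_mul, Polynomial.eval_C, norm_mul, hlc, Polynomial.eval_multiset_prod,
      Multiset.map_map]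
    congr 1
    have := map_multiset_prod (normHom : ℂ →*₀ ℝ) ((q.roots.map (fun w => z - w)))
    simp only [Multiset.map_map] at this
    simpa using this
  rw [h2]
  refine mul_le_mul_of_nonneg_left ?_ (norm_nonneg _)
  have hcard : q.roots.card = k := by rw [← hk]; exact hs.natDegree_eq_card_roots.symm
  rw [← hcard]
  have : ∀ s : Multiset ℂ, (∀ w ∈ s, δ ≤ ‖z - w‖) → δ ^ s.card ≤ (s.map (fun w => ‖z - w‖)).prod := by
    intro s
    induction s using Multiset.induction_on with
    | empty => simp
    | cons a s ih =>
      intro h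
      rw [Multiset.card_cons, Multiset.map_cons, Multiset.prod_cons, pow_succ']
      exact mul_le_mul (h a (by simp)) (ih fun w hw => h w (by simp [hw])) (by positivity)
        (norm_nonneg _)
  refine this _ fun w hw => hr w ?_
  exact (Polynomial.mem_roots'.mp hw).2

theorem root_cont {n k : ℕ} (A B0 B1 : Matrix (Fin n) (Fin n) ℂ) (hA : sgm n k A ≠ 0)
    (H R : Set ℂ) (hH : IsClosed H)
    (h1 : ∀ β ∈ Icc (0:ℝ) 1, ∀ z : ℂ, sgm n k (z • A + (B0 + (β : ℂ) • B1)) = 0 → z ∈ R ∨ z ∈ H)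
    (h2 : ∀ β ∈ Icc (0:ℝ) 1, ∀ z ∈ H, z ∈ closure R → sgm n k (z • A + (B0 + (β : ℂ) • B1)) ≠ 0)
    (h0 : ∀ z ∈ H, sgm n k (z • A + B0) ≠ 0) :
    ∀ z ∈ H, sgm n k (z • A + (B0 + B1)) ≠ 0 := by
  set F : ℝ → ℂ → ℂ := fun β z => sgm n k (z • A + (B0 + (β : ℂ) • B1)) with hFdef
  have hF : Continuous (fun p : ℝ × ℂ => F p.1 p.2) := by
    refine (sgm_continuous n k).comp ?_
    fun_prop
  -- boundedness of roots
  have hbd : ∃ ρ : ℝ, ∀ β ∈ Icc (0:ℝ) 1, ∀ z, F β z = 0 → ‖z‖ ≤ ρ := by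
    let G : ℂ × ℝ → ℂ := fun p => sgm n k (A + p.1 • (B0 + (p.2 : ℂ) • B1))
    have hG : Continuous G := by
      refine (sgm_continuous n k).comp ?_
      fun_prop
    have hopen : IsOpen {p | G p ≠ 0} := isOpen_ne_fun hG continuous_const
    have hsub : ({0} : Set ℂ) ×ˢ Icc (0:ℝ) 1 ⊆ {p | G p ≠ 0} := by
      rintro ⟨w, β⟩ ⟨hw, _⟩
      simp only [mem_singleton_iff] at hw
      subst hw
      simpa [G] using hA
    obtain ⟨u, v, hu, hv, h0u, hIv, huv⟩ := generalized_tube_lemma isCompact_singleton isCompact_Icc hopen hsub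
    obtain ⟨ε, hε, hball⟩ := Metric.isOpen_iff.mp hu 0 (h0u rfl)
    refine ⟨ε⁻¹, fun β hβ z hz => ?_⟩
    by_contra hlt
    push Not at hlt
    have hz0 : z ≠ 0 := by
      rintro rfl
      simp at hlt
      linarith
    have hmem : z⁻¹ ∈ u := by
      apply hball
      rw [mem_ball_zero_iff, norm_inv]
      exact inv_lt_of_inv_lt₀ hε hlt
    have hne : G (z⁻¹, β) ≠ 0 := huv (mk_mem_prod hmem (hIv hβ))
    apply hne
    have : F β z = z ^ k * G (z⁻¹, β) := by
      simp only [F, G]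
      rw [← sgm_smul]
      congr 1
      rw [smul_add, smul_smul z, mul_inv_cancel₀ hz0, one_smul]
    rw [this] at hz
    exact (mul_eq_zero.mp hz).resolve_left (pow_ne_zero _ hz0)
  obtain ⟨ρ, hρ⟩ := hbd
  -- the closed set of bad parameters
  let T : Set ℝ := Prod.fst '' ((Icc (0:ℝ) 1 ×ˢ (H ∩ closedBall 0 ρ)) ∩ {p : ℝ × ℂ | F p.1 p.2 = 0})
  have hT : IsClosed T := by
    refine IsCompact.isClosed (IsCompact.image ?_ continuous_fst)
    refine IsCompact.inter_right ?_ (isClosed_eq hF continuous_const)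
    exact isCompact_Icc.prod ((isCompact_closedBall _ _).inter_left hH)
  have key : ∀ β ∈ Icc (0:ℝ) 1, β ∈ Tᶜ ↔ ∀ z ∈ H, F β z ≠ 0 := by
    intro β hβ
    constructor
    · intro h z hz h3
      exact h ⟨(β, z), ⟨⟨hβ, hz, by simpa using hρ β hβ z h3⟩, h3⟩, rfl⟩
    · rintro h ⟨⟨b, z⟩, ⟨⟨_, hz, _⟩, h3⟩, rfl⟩
      exact h z hz h3
  have hall : Icc (0:ℝ) 1 ⊆ Tᶜ := by
    refine IsClosed.Icc_subset_of_forall_mem_nhdsWithin ?_ ?_ ?_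
    · rw [← closure_subset_iff_isClosed]
      intro β hβ
      have hβI : β ∈ Icc (0:ℝ) 1 := by
        have := closure_mono (inter_subset_right : Tᶜ ∩ Icc (0:ℝ) 1 ⊆ Icc 0 1) hβ
        rwa [isClosed_Icc.closure_eq] at this
      refine ⟨(key β hβI).2 ?_, hβI⟩
      intro z hz h3
      have hzR : z ∉ closure R := fun h => h2 β hβI z hz h h3
      obtain ⟨δ, hδ, hd⟩ := Metric.isOpen_iff.mp isClosed_closure.isOpen_compl z hzR
      have hle : ∀ b ∈ Tᶜ ∩ Icc (0:ℝ) 1, ‖sgm n k A‖ * δ ^ k ≤ ‖F b z‖ := by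
        rintro b ⟨hbT, hbI⟩
        obtain ⟨q, hq1, hq2, hq3⟩ := sgm_poly n k A (B0 + (b : ℂ) • B1)
        have := poly_lower q hq2 (by rw [hq3]; exact hA) (z := z) hδ.le ?_
        · rw [hq3, hq1] at this; exact this
        · intro w hw
          rw [hq1] at hw
          have hwR : w ∈ R := (h1 b hbI w hw).resolve_right fun hwH => (key b hbI).1 hbT w hwH hw
          by_contra hlt
          push Not at hlt
          exact hd (show w ∈ ball z δ by rwa [mem_ball, dist_comm, dist_eq_norm]) (subset_closure hwR)
      have hcl : β ∈ {b | ‖sgm n k A‖ * δ ^ k ≤ ‖F b z‖} := by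
        have hclosed : IsClosed {b | ‖sgm n k A‖ * δ ^ k ≤ ‖F b z‖} := by
          refine isClosed_le continuous_const ?_
          exact (hF.comp (by fun_prop : Continuous fun b : ℝ => (b, z))).norm
        exact hclosed.closure_subset_iff.mpr hle hβ
      simp only [mem_ofPred_eq, h3, norm_zero] at hcl
      have : 0 < ‖sgm n k A‖ * δ ^ k := by positivity
      linarith
    · rw [key 0 (by simp)]
      intro z hz
      simpa [F] using h0 z hz
    · intro x hx
      exact mem_nhdsWithin_of_mem_nhds (hT.isOpen_compl.mem_nhds hx.1)
  intro z hz
  have := (key 1 (by simp)).1 (hall (by simp)) z hz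
  simpa [F] using this

abbrev toC {n : ℕ} (A : Matrix (Fin n) (Fin n) ℝ) : Matrix (Fin n) (Fin n) ℂ :=
  A.map Complex.ofRealHom

theorem toC_sgm {n : ℕ} (k : ℕ) (A : Matrix (Fin n) (Fin n) ℝ) :
    sgm n k (toC A) = ((sgm n k A : ℝ) : ℂ) := (sgm_map Complex.ofRealHom n k A).symm

theorem toC_add {n : ℕ} (A B : Matrix (Fin n) (Fin n) ℝ) : toC (A + B) = toC A + toC B := by
  ext i j; simp

theorem toC_smul {n : ℕ} (c : ℝ) (A : Matrix (Fin n) (Fin n) ℝ) :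
    toC (c • A) = (c : ℂ) • toC A := by
  ext i j; simp

theorem toC_one {n : ℕ} : toC (1 : Matrix (Fin n) (Fin n) ℝ) = 1 := by
  ext i j; by_cases h : i = j <;> simp [h, Matrix.one_apply]

/-- roots of `sgm (A + z)` for `A` in the cone are negative reals -/
theorem Gam.shift_root {n k : ℕ} (hk : k ≤ n) {A : Matrix (Fin n) (Fin n) ℝ} (hA : Gam n k A)
    {z : ℂ} (hz : 0 ≤ z.re) : sgm n k (toC A + z • 1) ≠ 0 := by
  intro h
  have him := sgm_hyp hk hA.1 h
  have hzr : z = (z.re : ℂ) := by apply Complex.ext <;> simp [him]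
  rw [hzr, ← toC_one, ← toC_smul, ← toC_add, toC_sgm] at h
  have := hA.shift_pos hk hz
  exact this.ne' (by exact_mod_cast h)

theorem Gam.pos {n k : ℕ} (hk : k ≤ n) {A : Matrix (Fin n) (Fin n) ℝ} (hA : Gam n k A) :
    0 < sgm n k A := by
  simpa using hA.shift_pos hk le_rfl

theorem Gam_one (n k : ℕ) (hk : k ≤ n) : Gam n k 1 := by
  refine ⟨Matrix.isSymm_one, fun j h1 h2 => ?_⟩
  unfold sgm
  refine Finset.sum_pos (fun s _ => ?_) (Finset.powersetCard_nonempty.2 (by simp; omega))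
  rw [Matrix.submatrix_one _ Subtype.val_injective, Matrix.det_one]
  exact one_pos

theorem garding1 {n k : ℕ} (hk : k ≤ n) {A X : Matrix (Fin n) (Fin n) ℝ} (hA : Gam n k A)
    (hX : X.IsSymm) {z : ℂ} (hz : 0 ≤ z.im) :
    sgm n k (z • toC A + (Complex.I • 1 + toC X)) ≠ 0 := by
  refine root_cont (toC A) (Complex.I • 1) (toC X) ?_ {z | 0 ≤ z.im} {z | z.im < 0} ?_ ?_ ?_ ?_ z hz
  · rw [toC_sgm]; exact_mod_cast (hA.pos hk).ne'
  · exact isClosed_le continuous_const Complex.continuous_im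
  · intro β _ z _
    simp only [mem_ofPred_eq]
    exact lt_or_ge _ _
  · intro β _ z hz1 hz2 h
    have hz3 : z.im ≤ 0 := by
      have hcl : closure {z : ℂ | z.im < 0} ⊆ {z | z.im ≤ 0} :=
        closure_minimal (fun w (hw : w.im < 0) => (le_of_lt hw : w.im ≤ 0)) (isClosed_le Complex.continuous_im continuous_const)
      exact hcl hz2
    have hz4 : z = (z.re : ℂ) := by
      apply Complex.ext <;> simp [le_antisymm hz3 hz1]
    have : z • toC A + (Complex.I • 1 + (β : ℂ) • toC X) = toC (z.re • A + β • X) + Complex.I • 1 := by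
      rw [toC_add, toC_smul, toC_smul, ← hz4]; abel
    rw [this] at h
    have := sgm_hyp hk ((hA.1.smul _).add (hX.smul _)) h
    simp at this
  · intro z hz h
    by_cases hz0 : z = 0
    · subst hz0
      rw [zero_smul, zero_add, sgm_smul, ← toC_one, toC_sgm] at h
      have := (Gam_one n k hk).pos hk
      have h2 : ((sgm n k (1 : Matrix (Fin n) (Fin n) ℝ) : ℝ) : ℂ) ≠ 0 := by exact_mod_cast this.ne'
      exact mul_ne_zero (pow_ne_zero _ Complex.I_ne_zero) h2 h
    · have : z • toC A + Complex.I • 1 = z • (toC A + (Complex.I / z) • 1) := by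
        rw [smul_add, smul_smul, mul_div_cancel₀ _ hz0]
      rw [this, sgm_smul] at h
      refine hA.shift_root hk ?_ ((mul_eq_zero.mp h).resolve_left (pow_ne_zero _ hz0))
      rw [Complex.div_re]
      simp
      exact div_nonneg hz (Complex.normSq_nonneg _)

/-- lower bound in the upper half plane -/
theorem garding2 {n k : ℕ} (hk : k ≤ n) {A X : Matrix (Fin n) (Fin n) ℝ} (hA : Gam n k A)
    (hX : X.IsSymm) {z : ℂ} (hz : 0 < z.im) :
    sgm n k (z • toC A + toC X) ≠ 0 := by
  have hA0 : sgm n k (toC A) ≠ 0 := by rw [toC_sgm]; exact_mod_cast (hA.pos hk).ne'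
  have hle : ∀ ε ∈ Ioi (0:ℝ), ‖sgm n k (toC A)‖ * z.im ^ k ≤
      ‖sgm n k (z • toC A + (((ε : ℂ) * Complex.I) • 1 + toC X))‖ := by
    intro ε hε
    obtain ⟨q, hq1, hq2, hq3⟩ := sgm_poly n k (toC A) (((ε : ℂ) * Complex.I) • 1 + toC X)
    have := poly_lower q hq2 (by rw [hq3]; exact hA0) (z := z) hz.le ?_
    · rw [hq3, hq1] at this; exact this
    · intro w hw
      rw [hq1] at hw
      have hw0 : w.im < 0 := by
        by_contra hge
        push Not at hge
        have hε0 : (ε : ℂ) ≠ 0 := by exact_mod_cast (ne_of_gt hε)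
        have e1 : w • toC A + (((ε : ℂ) * Complex.I) • 1 + toC X) =
            (ε : ℂ) • (((ε⁻¹ : ℝ) * w) • toC A + (Complex.I • 1 + toC (ε⁻¹ • X))) := by
          rw [toC_smul]
          simp only [smul_add, smul_smul]
          push_cast
          rw [← mul_assoc, mul_inv_cancel₀ hε0, one_mul, one_smul]
        rw [e1, sgm_smul] at hw
        refine garding1 hk hA (hX.smul ε⁻¹) ?_ ((mul_eq_zero.mp hw).resolve_left (pow_ne_zero _ hε0))
        rw [Complex.im_ofReal_mul]
        exact mul_nonneg (inv_nonneg.2 (le_of_lt hε)) hge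
      calc z.im ≤ (z - w).im := by rw [Complex.sub_im]; linarith
        _ ≤ |(z - w).im| := le_abs_self _
        _ ≤ _ := Complex.abs_im_le_norm _
  have h0 : (0:ℝ) ∈ {ε : ℝ | ‖sgm n k (toC A)‖ * z.im ^ k ≤
      ‖sgm n k (z • toC A + (((ε : ℂ) * Complex.I) • 1 + toC X))‖} := by
    have hclosed : IsClosed {ε : ℝ | ‖sgm n k (toC A)‖ * z.im ^ k ≤
      ‖sgm n k (z • toC A + (((ε : ℂ) * Complex.I) • 1 + toC X))‖} := by
      refine isClosed_le continuous_const (Continuous.norm ?_)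
      refine (sgm_continuous n k).comp ?_
      fun_prop
    have := hclosed.closure_subset_iff.mpr hle
    apply this
    rw [closure_Ioi]
    simp
  intro h
  simp only [mem_ofPred_eq, Complex.ofReal_zero, zero_mul, zero_smul, zero_add, h, norm_zero] at h0
  have : 0 < ‖sgm n k (toC A)‖ * z.im ^ k := by positivity
  linarith

theorem garding3 {n k : ℕ} (hk : k ≤ n) {A X : Matrix (Fin n) (Fin n) ℝ} (hA : Gam n k A)
    (hX : X.IsSymm) {z : ℂ} (hz : sgm n k (z • toC A + toC X) = 0) : z.im = 0 := by
  rcases lt_trichotomy z.im 0 with h | h | h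
  · exfalso
    have h2 : sgm n k ((-z) • toC A + toC (-X)) = 0 := by
      have : (-z) • toC A + toC (-X) = (-1 : ℂ) • (z • toC A + toC X) := by
        have e : toC (-X) = - toC X := by ext i j; simp
        rw [e]; simp
      rw [this, sgm_smul, hz, mul_zero]
    exact garding2 hk hA hX.neg (by simpa using h) h2
  · exact h
  · exact absurd hz (garding2 hk hA hX h)

theorem Gam.mono {n k j : ℕ} {A : Matrix (Fin n) (Fin n) ℝ} (hA : Gam n k A) (h : j ≤ k) :
    Gam n j A := ⟨hA.1, fun i h1 h2 => hA.2 i h1 (h2.trans h)⟩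

theorem Gam.smul {n k : ℕ} {A : Matrix (Fin n) (Fin n) ℝ} (hA : Gam n k A) {c : ℝ} (hc : 0 < c) :
    Gam n k (c • A) := ⟨hA.1.smul _, fun i h1 h2 => by
      rw [sgm_smul]; exact mul_pos (pow_pos hc _) (hA.2 i h1 h2)⟩

theorem Gam.segment_pos {n k : ℕ} (hk : k ≤ n) {B : Matrix (Fin n) (Fin n) ℝ} (hB : Gam n k B)
    {s : ℝ} (hs : s ∈ Icc (0:ℝ) 1) : 0 < sgm n k (1 + s • (B - 1)) := by
  rcases eq_or_lt_of_le hs.1 with h | h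
  · rw [← h]; simpa using (Gam_one n k hk).pos hk
  · have : 1 + s • (B - 1) = s • B + (1 - s) • 1 := by
      rw [smul_sub, sub_smul, one_smul]; abel
    rw [this]
    exact (hB.smul h).shift_pos hk (by linarith [hs.2])

theorem garding4 {n k : ℕ} (hk : k ≤ n) {A B : Matrix (Fin n) (Fin n) ℝ} (hA : Gam n k A)
    (hB : Gam n k B) : 0 < sgm n k (A + B) := by
  have hA0 : sgm n k (toC A) ≠ 0 := by rw [toC_sgm]; exact_mod_cast (hA.pos hk).ne'
  have hsym : ∀ s : ℝ, (1 + s • (B - 1)).IsSymm := fun s =>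
    Matrix.isSymm_one.add ((hB.1.sub Matrix.isSymm_one).smul _)
  have hconv : ∀ s : ℝ, (1 : Matrix (Fin n) (Fin n) ℂ) + (s : ℂ) • toC (B - 1) = toC (1 + s • (B - 1)) := by
    intro s; rw [toC_add, toC_smul, toC_one]
  have main : ∀ z ∈ {z : ℂ | z.im = 0 ∧ 0 ≤ z.re}, sgm n k (z • toC A + (1 + toC (B - 1))) ≠ 0 := by
    refine root_cont (toC A) 1 (toC (B - 1)) hA0 {z : ℂ | z.im = 0 ∧ 0 ≤ z.re}
      {z : ℂ | z.im = 0 ∧ z.re < 0} ?_ ?_ ?_ ?_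
    · exact (isClosed_eq Complex.continuous_im continuous_const).inter
        (isClosed_le continuous_const Complex.continuous_re)
    · intro s hs z hz
      rw [hconv] at hz
      have := garding3 hk hA (hsym s) hz
      rcases lt_or_ge z.re 0 with h | h
      · exact Or.inl ⟨this, h⟩
      · exact Or.inr ⟨this, h⟩
    · intro s hs z hz1 hz2 h
      have hz3 : z.re ≤ 0 := by
        have hcl : closure {z : ℂ | z.im = 0 ∧ z.re < 0} ⊆ {z | z.re ≤ 0} :=
          closure_minimal (fun w (hw : w.im = 0 ∧ w.re < 0) => (le_of_lt hw.2 : w.re ≤ 0)) (isClosed_le Complex.continuous_re continuous_const)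
        exact hcl hz2
      have hz4 : z = 0 := Complex.ext (le_antisymm hz3 hz1.2) hz1.1
      rw [hz4, zero_smul, zero_add, hconv, toC_sgm] at h
      exact (hB.segment_pos hk hs).ne' (by exact_mod_cast h)
    · intro z hz h
      by_cases hz0 : z = 0
      · rw [hz0, zero_smul, zero_add, ← toC_one, toC_sgm] at h
        exact ((Gam_one n k hk).pos hk).ne' (by exact_mod_cast h)
      · have : z • toC A + 1 = z • (toC A + z⁻¹ • 1) := by
          rw [smul_add, smul_smul, mul_inv_cancel₀ hz0, one_smul]
        rw [this, sgm_smul] at h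
        refine hA.shift_root hk ?_ ((mul_eq_zero.mp h).resolve_left (pow_ne_zero _ hz0))
        rw [Complex.inv_re]
        exact div_nonneg hz.2 (Complex.normSq_nonneg _)
  have hne : ∀ w ∈ Ici (0:ℝ), sgm n k (w • A + B) ≠ 0 := by
    intro w hw h
    refine main (w : ℂ) ⟨by simp, by simpa using hw⟩ ?_
    have e : (w : ℂ) • toC A + (1 + toC (B - 1)) = toC (w • A + B) := by
      rw [toC_add, toC_smul, ← toC_one, ← toC_add]; congr 2; abel
    rw [e, toC_sgm, h, Complex.ofReal_zero]
  have hcont : Continuous fun w : ℝ => sgm n k (w • A + B) :=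
    (sgm_continuous n k).comp (by fun_prop)
  by_contra hneg
  push Not at hneg
  have h0 : 0 < sgm n k ((0:ℝ) • A + B) := by simpa using hB.pos hk
  have h1 : sgm n k ((1:ℝ) • A + B) ≤ 0 := by simpa using hneg
  obtain ⟨w, hw, hw2⟩ := intermediate_value_Icc' (zero_le_one (α := ℝ)) hcont.continuousOn ⟨h1, h0.le⟩
  exact hne w hw.1 hw2

theorem Gam.add {n k : ℕ} (hk : k ≤ n) {A B : Matrix (Fin n) (Fin n) ℝ} (hA : Gam n k A)
    (hB : Gam n k B) : Gam n k (A + B) :=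
  ⟨hA.1.add hB.1, fun j _ h2 => garding4 (h2.trans hk) (hA.mono h2) (hB.mono h2)⟩

theorem Gam_of_posDef {n k : ℕ} (hk : k ≤ n) {A : Matrix (Fin n) (Fin n) ℝ} (hA : A.PosDef) :
    Gam n k A := by
  refine ⟨?_, fun j h1 h2 => ?_⟩
  · have := hA.isHermitian
    ext i j
    have := this.apply i j
    simpa using this
  · unfold sgm
    refine Finset.sum_pos (fun s _ => ?_) (Finset.powersetCard_nonempty.2 (by simp; omega))
    exact (hA.submatrix Subtype.val_injective).det_pos

/-- the closure property actually used -/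
theorem garding_final {n k : ℕ} (hk : k ≤ n) {A B P : Matrix (Fin n) (Fin n) ℝ} (hA : Gam n k A)
    (hB : Gam n k B) (hP : P.PosSemidef) {s : ℝ} (hs : s ∈ Icc (0:ℝ) 1) :
    0 ≤ sgm n k ((1 - s) • A + s • B + P) := by
  have hAB : Gam n k ((1 - s) • A + s • B) := by
    rcases eq_or_lt_of_le hs.1 with h | h
    · rw [← h]; simpa using hA
    · rcases eq_or_lt_of_le hs.2 with h' | h'
      · rw [h']; simpa using hB
      · exact (hA.smul (by linarith)).add hk (hB.smul h)
  have hle : ∀ ε ∈ Ioi (0:ℝ), 0 ≤ sgm n k ((1 - s) • A + s • B + (P + ε • 1)) := by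
    intro ε hε
    refine (garding4 hk hAB (Gam_of_posDef hk ?_)).le
    exact Matrix.PosDef.posSemidef_add hP (Matrix.PosDef.one.smul hε)
  have hclosed : IsClosed {ε : ℝ | 0 ≤ sgm n k ((1 - s) • A + s • B + (P + ε • 1))} := by
    refine isClosed_le continuous_const ?_
    exact (sgm_continuous n k).comp (by fun_prop)
  have h0 : (0:ℝ) ∈ closure (Ioi (0:ℝ)) := by rw [closure_Ioi]; simp
  have := hclosed.closure_subset_iff.mpr hle h0
  simpa using this


theorem sum_powersetCard_sum (n j : ℕ) (hj : 1 ≤ j) (hn : 1 ≤ n) (a : Fin n → ℝ) :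
    ∑ s ∈ (Finset.univ : Finset (Fin n)).powersetCard j, ∑ i ∈ s, a i =
      ((n-1).choose (j-1) : ℝ) * ∑ i, a i := by
  have h1 : ∀ s : Finset (Fin n), ∑ i ∈ s, a i = ∑ i, if i ∈ s then a i else 0 := by
    intro s
    rw [← Finset.sum_filter]; simp
  simp_rw [h1]
  rw [Finset.sum_comm, Finset.mul_sum]
  refine Finset.sum_congr rfl fun i _ => ?_
  rw [← Finset.sum_filter, Finset.sum_const, nsmul_eq_mul]
  congr 2
  on_goal 2 => simp
  have h2 := Finset.card_filter_add_card_filter_not (s := (Finset.univ : Finset (Fin n)).powersetCard j) (fun s => i ∈ s)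
  have h3 : ((Finset.univ : Finset (Fin n)).powersetCard j).filter (fun s => ¬ i ∈ s) =
      (Finset.univ.erase i).powersetCard j := by
    ext s
    simp only [Finset.mem_filter, Finset.mem_powersetCard, Finset.subset_univ, true_and,
      Finset.subset_erase]
    tauto
  rw [h3, Finset.card_powersetCard, Finset.card_powersetCard, Finset.card_erase_of_mem (Finset.mem_univ _),
    Finset.card_univ, Fintype.card_fin] at h2
  obtain ⟨m, rfl⟩ : ∃ m, n = m + 1 := ⟨n - 1, by omega⟩
  obtain ⟨l, rfl⟩ : ∃ l, j = l + 1 := ⟨j - 1, by omega⟩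
  rw [Nat.choose_succ_succ'] at h2
  simp only [Nat.add_sub_cancel] at h2 ⊢
  omega

theorem sgm_rank1 (n j : ℕ) (hj : 1 ≤ j) (hn : 1 ≤ n) (b : ℝ) (e : Fin n → ℝ) :
    sgm n j (1 - b • Matrix.vecMulVec e e) =
      (n.choose j : ℝ) - b * (((n-1).choose (j-1) : ℝ) * ∑ i, e i ^ 2) := by
  rw [← sum_powersetCard_sum n j hj hn, Finset.mul_sum]
  have : (n.choose j : ℝ) = ∑ s ∈ (Finset.univ : Finset (Fin n)).powersetCard j, (1:ℝ) := by simp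
  rw [this, ← Finset.sum_sub_distrib]
  unfold sgm
  refine Finset.sum_congr rfl fun s _ => ?_
  have h := Matrix.det_one_add_replicateCol_mul_replicateRow (ι := Unit)
    (fun i : {i // i ∈ s} => -b * e i) (fun i : {i // i ∈ s} => e i)
  have e1 : (1 - b • Matrix.vecMulVec e e).submatrix (fun i : {i // i ∈ s} => (i : Fin n))
      (fun i : {i // i ∈ s} => (i : Fin n)) = 1 + Matrix.replicateCol Unit (fun i : {i // i ∈ s} => -b * e i)
        * Matrix.replicateRow Unit (fun i : {i // i ∈ s} => e i) := by
    ext p q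
    by_cases hpq : p = q
    · subst hpq
      simp [Matrix.mul_apply, Matrix.vecMulVec_apply]
      ring
    · have hpq' : (p : Fin n) ≠ q := fun h => hpq (Subtype.ext h)
      simp [Matrix.mul_apply, Matrix.vecMulVec_apply, Matrix.one_apply_ne hpq, Matrix.one_apply_ne hpq']
      ring
  rw [e1, h, dotProduct]
  have : ∑ i : {i // i ∈ s}, e i * (-b * e i) = -b * ∑ i ∈ s, e i ^ 2 := by
    rw [Finset.mul_sum, ← Finset.sum_coe_sort s]
    refine Finset.sum_congr rfl fun i _ => by ring
  rw [this]; ring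

theorem det_one_add_smul (n : ℕ) (t : ℝ) (A : Matrix (Fin n) (Fin n) ℝ) :
    (1 + t • A).det = ∑ j ∈ Finset.range (n+1), t ^ j * sgm n j A := by
  have h := fun k => Matrix.coeff_det_one_add_X_smul_eq_sum_minors A k
  set p := (1 + (Polynomial.X : Polynomial ℝ) • A.map Polynomial.C).det with hp
  have h1 : p.eval t = (1 + t • A).det := by
    rw [hp, ← Polynomial.coe_evalRingHom, RingHom.map_det]
    congr 1
    ext i j
    by_cases hij : i = j <;> simp [hij, mul_comm t]
  have hdeg : p.natDegree < n + 1 := by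
    have := Polynomial.natDegree_det_X_add_C_le A (1 : Matrix (Fin n) (Fin n) ℝ)
    rw [Fintype.card_fin] at this
    rw [hp, add_comm]
    simp only [Matrix.map_one, map_one, map_zero] at this
    omega
  rw [← h1, Polynomial.eval_eq_sum_range' hdeg]
  refine Finset.sum_congr rfl fun j _ => ?_
  rw [h j, mul_comm]
  rfl


/-- coordinates of gradient -/
noncomputable def gradc (n : ℕ) (U : EuclideanSpace ℝ (Fin n) → ℝ) (x : EuclideanSpace ℝ (Fin n)) :
    EuclideanSpace ℝ (Fin n) :=
  WithLp.toLp 2 (fun i => fderiv ℝ U x (EuclideanSpace.single i 1))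

theorem hess_apply (n : ℕ) (U : EuclideanSpace ℝ (Fin n) → ℝ) (x : EuclideanSpace ℝ (Fin n))
    (i j : Fin n) : hessianMatrix n U x i j =
      fderiv ℝ (fderiv ℝ U) x (EuclideanSpace.single i 1) (EuclideanSpace.single j 1) := by
  simp [hessianMatrix, iteratedFDeriv_two_apply]

theorem gradc_contDiff {n : ℕ} {U : EuclideanSpace ℝ (Fin n) → ℝ} (hU : ContDiff ℝ 2 U) :
    ContDiff ℝ 1 (gradc n U) := by
  have h1 : ContDiff ℝ 1 (fderiv ℝ U) := hU.fderiv_right (by norm_num)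
  rw [contDiff_euclidean]
  intro i
  exact h1.clm_apply contDiff_const

theorem gradc_fderiv {n : ℕ} {U : EuclideanSpace ℝ (Fin n) → ℝ} (hU : ContDiff ℝ 2 U)
    (x : EuclideanSpace ℝ (Fin n)) (i j : Fin n) :
    fderiv ℝ (gradc n U) x (EuclideanSpace.single j 1) i = hessianMatrix n U x j i := by
  have h1 : ContDiff ℝ 1 (fderiv ℝ U) := hU.fderiv_right (by norm_num)
  have hd : DifferentiableAt ℝ (gradc n U) x := (gradc_contDiff hU).differentiable (by norm_num) x
  have hd1 : DifferentiableAt ℝ (fderiv ℝ U) x := h1.differentiable (by norm_num) x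
  have h2 := (EuclideanSpace.proj (𝕜 := ℝ) i).hasFDerivAt.comp x hd.hasFDerivAt
  have h3 : HasFDerivAt (fun y => fderiv ℝ U y (EuclideanSpace.single i 1)) _ x :=
    hd1.hasFDerivAt.clm_apply (hasFDerivAt_const _ _)
  have h4 := h2.unique h3
  have h5 := congrArg (fun L => L (EuclideanSpace.single j 1)) h4
  rw [hess_apply]
  simpa using h5

theorem hess_continuous {n : ℕ} {U : EuclideanSpace ℝ (Fin n) → ℝ} (hU : ContDiff ℝ 2 U) :
    Continuous (hessianMatrix n U) := by
  have h1 : ContDiff ℝ 1 (fderiv ℝ U) := hU.fderiv_right (by norm_num)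
  have h2 : Continuous (fderiv ℝ (fderiv ℝ U)) := h1.continuous_fderiv (by norm_num)
  refine continuous_matrix fun i j => ?_
  simp_rw [hess_apply]
  exact (h2.clm_apply continuous_const).clm_apply continuous_const

theorem det_Phi {n : ℕ} {U : EuclideanSpace ℝ (Fin n) → ℝ} (hU : ContDiff ℝ 2 U)
    (x : EuclideanSpace ℝ (Fin n)) (t : ℝ) :
    (ContinuousLinearMap.id ℝ (EuclideanSpace ℝ (Fin n)) + t • fderiv ℝ (gradc n U) x).det =
      (1 + t • hessianMatrix n U x).det := by
  rw [ContinuousLinearMap.det, ← LinearMap.det_toMatrix (EuclideanSpace.basisFun (Fin n) ℝ).toBasis,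
    ← Matrix.det_transpose]
  congr 1
  ext i j
  rw [Matrix.transpose_apply, LinearMap.toMatrix_apply]
  have := gradc_fderiv hU x j i
  by_cases hij : i = j <;> simp [hij, this, Matrix.one_apply] <;> simp [hij] at this <;> try simp [this]

theorem null_lagr {n k : ℕ} (hk1 : 1 ≤ k) (hkn : k ≤ n) {U : EuclideanSpace ℝ (Fin n) → ℝ}
    (hU : ContDiff ℝ 2 U) (hc : HasCompactSupport U) :
    ∫ x, SkHess n k U x = 0 := by
  obtain ⟨r, hr⟩ := hc.isCompact.isBounded.subset_closedBall (0 : EuclideanSpace ℝ (Fin n))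
  set B := closedBall (0 : EuclideanSpace ℝ (Fin n)) r
  have hBc : IsCompact B := isCompact_closedBall _ _
  have hG0 : ∀ x ∉ B, gradc n U x = 0 := by
    intro x hx
    have h : fderiv ℝ U x = 0 := image_eq_zero_of_notMem_tsupport
      fun h => hx (hr (tsupport_fderiv_subset ℝ h))
    ext i; simp [gradc, h]
  have hH0 : ∀ x ∉ B, hessianMatrix n U x = 0 := by
    intro x hx
    have h : fderiv ℝ (fderiv ℝ U) x = 0 := image_eq_zero_of_notMem_tsupport
      fun h => hx (hr (tsupport_fderiv_subset ℝ (tsupport_fderiv_subset ℝ h)))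
    ext i j; rw [hess_apply, h]; simp
  have hGs : HasCompactSupport (gradc n U) := HasCompactSupport.intro hBc hG0
  obtain ⟨K, hK⟩ := (gradc_contDiff hU).lipschitzWith_of_hasCompactSupport hGs (by norm_num)
  have hHc := hess_continuous hU
  -- uniform positivity
  obtain ⟨ε, hε, hpos⟩ : ∃ ε > 0, ∀ t ∈ ball (0:ℝ) ε, ∀ x ∈ B, 0 < (1 + t • hessianMatrix n U x).det := by
    have hopen : IsOpen {p : ℝ × EuclideanSpace ℝ (Fin n) | 0 < (1 + p.1 • hessianMatrix n U p.2).det} := by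
      refine isOpen_lt continuous_const (Continuous.matrix_det ?_)
      exact continuous_const.add (continuous_fst.smul (hHc.comp continuous_snd))
    have hsub : ({0} : Set ℝ) ×ˢ B ⊆ {p : ℝ × EuclideanSpace ℝ (Fin n) | 0 < (1 + p.1 • hessianMatrix n U p.2).det} := by
      rintro ⟨w, β⟩ ⟨hw, _⟩
      simp only [mem_singleton_iff] at hw
      subst hw
      simp
    obtain ⟨u, v, hu, hv, h0u, hIv, huv⟩ := generalized_tube_lemma isCompact_singleton hBc hopen hsub
    obtain ⟨ε, hε, hball⟩ := Metric.isOpen_iff.mp hu 0 (h0u rfl)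
    exact ⟨ε, hε, fun t ht x hx => huv (mk_mem_prod (hball ht) (hIv hx))⟩
  have hvol : ∀ t ∈ Ioo (0:ℝ) (min ε (1 / (K + 1))),
      ∫ x in B, (1 + t • hessianMatrix n U x).det = ∫ x in B, (1:ℝ) := by
    intro t ht
    have ht0 : 0 < t := ht.1
    have htε : t < ε := ht.2.trans_le (min_le_left _ _)
    have htK : t < 1 / (K + 1) := ht.2.trans_le (min_le_right _ _)
    have hK1 : (0:ℝ) < K + 1 := by positivity
    have htK2 : t * K < 1 := by
      rw [lt_div_iff₀ hK1] at htK; nlinarith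
    have hLip : ∀ x y, ‖t • gradc n U x - t • gradc n U y‖ ≤ (t * K) * ‖x - y‖ := by
      intro x y
      rw [← smul_sub, norm_smul, Real.norm_of_nonneg ht0.le, mul_assoc]
      have := hK.dist_le_mul x y
      rw [dist_eq_norm, dist_eq_norm] at this
      gcongr
    set Φ : EuclideanSpace ℝ (Fin n) → EuclideanSpace ℝ (Fin n) := fun x => x + t • gradc n U x with hΦ
    have hinj : Function.Injective Φ := by
      intro x y hxy
      have h1 : x - y = -(t • gradc n U x - t • gradc n U y) := by
        have : x + t • gradc n U x = y + t • gradc n U y := hxy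
        rw [← sub_eq_zero] at this ⊢
        rw [← this]; abel
      have h2 := hLip x y
      rw [← norm_neg, ← h1] at h2
      have h3 : ‖x - y‖ = 0 := by
        by_contra hne
        have : 0 < ‖x - y‖ := lt_of_le_of_ne (norm_nonneg _) (Ne.symm hne)
        nlinarith
      exact sub_eq_zero.mp (norm_eq_zero.mp h3)
    have hsurj : Function.Surjective Φ := by
      intro y
      have hcw : ContractingWith (Real.toNNReal (t * K)) (fun x => y - t • gradc n U x) := by
        refine ⟨?_, ?_⟩
        · rw [← NNReal.coe_lt_coe, Real.coe_toNNReal _ (by positivity)]; exact htK2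
        · refine LipschitzWith.of_dist_le_mul fun a b => ?_
          rw [dist_eq_norm, dist_eq_norm, Real.coe_toNNReal _ (by positivity), norm_sub_rev a b]
          refine le_trans (le_of_eq ?_) (hLip b a)
          congr 1; abel
      refine ⟨ContractingWith.fixedPoint _ hcw, ?_⟩
      have := hcw.fixedPoint_isFixedPt
      rw [Function.IsFixedPt] at this
      simp only [hΦ]
      nth_rewrite 1 [← this]
      abel
    have himg : Φ '' B = B := by
      have hfix : ∀ x ∉ B, Φ x = x := fun x hx => by simp [hΦ, hG0 x hx]
      ext y
      constructor
      · rintro ⟨x, hx, rfl⟩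
        by_contra hy
        have := hinj (hfix _ hy)
        rw [this] at hy
        exact hy hx
      · intro hy
        obtain ⟨x, rfl⟩ := hsurj y
        refine ⟨x, ?_, rfl⟩
        by_contra hx
        rw [hfix x hx] at hy
        exact hx hy
    have hder : ∀ x ∈ B, HasFDerivWithinAt Φ
        (ContinuousLinearMap.id ℝ (EuclideanSpace ℝ (Fin n)) + t • fderiv ℝ (gradc n U) x) B x := by
      intro x _
      have hd : DifferentiableAt ℝ (gradc n U) x := (gradc_contDiff hU).differentiable (by norm_num) x
      exact ((hasFDerivAt_id x).add (hd.hasFDerivAt.const_smul t)).hasFDerivWithinAt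
    have hcv := integral_image_eq_integral_abs_det_fderiv_smul volume hBc.measurableSet hder
      hinj.injOn (fun _ => (1:ℝ))
    rw [himg] at hcv
    rw [hcv]
    refine setIntegral_congr_fun hBc.measurableSet fun x hx => ?_
    simp only [det_Phi hU, smul_eq_mul, mul_one]
    rw [abs_of_pos (hpos t (by rw [mem_ball_zero_iff, Real.norm_of_nonneg ht0.le]; exact htε) x hx)]
  have hcont : ∀ j, Continuous fun x => sgm n j (hessianMatrix n U x) := fun j =>
    (sgm_continuous n j).comp hHc
  have hint : ∀ j, IntegrableOn (fun x => sgm n j (hessianMatrix n U x)) B := fun j =>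
    (hcont j).continuousOn.integrableOn_compact hBc
  let p : Polynomial ℝ := (∑ j ∈ Finset.range (n+1), Polynomial.C (∫ x in B, sgm n j (hessianMatrix n U x)) * Polynomial.X ^ j)
    - Polynomial.C (∫ x in B, (1:ℝ))
  have hp0 : p = 0 := by
    refine Polynomial.eq_zero_of_infinite_isRoot p (Set.Infinite.mono ?_ (Ioo_infinite (a := (0:ℝ)) (b := min ε (1 / (K + 1))) ?_))
    · intro t ht
      have := hvol t ht
      simp_rw [det_one_add_smul] at this
      rw [integral_finsetSum _ (fun j _ => (hint j).const_mul _)] at this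
      simp_rw [integral_const_mul] at this
      show p.eval t = 0
      simp only [p, Polynomial.eval_sub, Polynomial.eval_finsetSum, Polynomial.eval_mul, Polynomial.eval_C,
        Polynomial.eval_pow, Polynomial.eval_X]
      rw [← this, sub_eq_zero]
      exact Finset.sum_congr rfl fun j _ => mul_comm _ _
    · exact lt_min hε (by positivity)
  have hck : p.coeff k = ∫ x in B, sgm n k (hessianMatrix n U x) := by
    simp only [p, Polynomial.coeff_sub, Polynomial.finsetSum_coeff, Polynomial.coeff_C_mul,
      Polynomial.coeff_X_pow, Polynomial.coeff_C]
    have : k ≠ 0 := by omega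
    simp [this]
    intro h; omega
  rw [hp0, Polynomial.coeff_zero] at hck
  have hz : ∀ x, x ∉ B → SkHess n k U x = 0 := by
    intro x hx
    rw [SkHess, sgm_real, hH0 x hx]
    have := sgm_smul n k (0:ℝ) 0
    rw [zero_smul, zero_pow (by omega), zero_mul] at this
    exact this
  rw [← setIntegral_eq_integral_of_forall_compl_eq_zero hz]
  exact hck.symm


theorem hess_congr {n : ℕ} {f g : EuclideanSpace ℝ (Fin n) → ℝ} {x : EuclideanSpace ℝ (Fin n)}
    (h : f =ᶠ[nhds x] g) : hessianMatrix n f x = hessianMatrix n g x := by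
  ext i j
  rw [hess_apply, hess_apply, (h.fderiv).fderiv_eq]

theorem hess_add {n : ℕ} {f g : EuclideanSpace ℝ (Fin n) → ℝ} {x : EuclideanSpace ℝ (Fin n)}
    (hf : ContDiffAt ℝ 2 f x) (hg : ContDiffAt ℝ 2 g x) :
    hessianMatrix n (fun y => f y + g y) x = hessianMatrix n f x + hessianMatrix n g x := by
  ext i j
  have : (fun y => f y + g y) = f + g := rfl
  simp only [hessianMatrix, Matrix.of_apply, Matrix.add_apply, this]
  rw [iteratedFDeriv_add_apply (by exact_mod_cast hf) (by exact_mod_cast hg)]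
  rfl

theorem hess_sub {n : ℕ} {f g : EuclideanSpace ℝ (Fin n) → ℝ} {x : EuclideanSpace ℝ (Fin n)}
    (hf : ContDiffAt ℝ 2 f x) (hg : ContDiffAt ℝ 2 g x) :
    hessianMatrix n (fun y => f y - g y) x = hessianMatrix n f x - hessianMatrix n g x := by
  have h := hess_add (hf.sub hg) hg
  rw [eq_sub_iff_add_eq, ← h]
  congr 1
  ext y; simp

theorem hess_symm {n : ℕ} {f : EuclideanSpace ℝ (Fin n) → ℝ} {x : EuclideanSpace ℝ (Fin n)}
    (hf : ContDiffAt ℝ 2 f x) : (hessianMatrix n f x).IsSymm := by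
  ext i j
  rw [Matrix.transpose_apply, hess_apply, hess_apply]
  exact (hf.isSymmSndFDerivAt (by simp)).eq _ _

theorem hess_comp {n : ℕ} {w : EuclideanSpace ℝ (Fin n) → ℝ} {x : EuclideanSpace ℝ (Fin n)}
    {φ : ℝ → ℝ} (hφ : ContDiffAt ℝ 2 φ (w x)) (hw : ContDiffAt ℝ 2 w x) :
    hessianMatrix n (fun y => φ (w y)) x = deriv φ (w x) • hessianMatrix n w x +
      deriv (deriv φ) (w x) • Matrix.vecMulVec (gradc n w x) (gradc n w x) := by
  have h1 : ∀ᶠ y in nhds x, DifferentiableAt ℝ w y := by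
    filter_upwards [hw.eventually (by simp)] with y hy
    exact hy.differentiableAt (by simp)
  have h2 : ∀ᶠ y in nhds x, DifferentiableAt ℝ φ (w y) := by
    have : ∀ᶠ s in nhds (w x), DifferentiableAt ℝ φ s := by
      filter_upwards [hφ.eventually (by simp)] with y hy
      exact hy.differentiableAt (by simp)
    exact hw.continuousAt.eventually this
  have h3 : fderiv ℝ (fun y => φ (w y)) =ᶠ[nhds x] fun y => deriv φ (w y) • fderiv ℝ w y := by
    filter_upwards [h1, h2] with y hy1 hy2
    exact (hy2.hasDerivAt.comp_hasFDerivAt y hy1.hasFDerivAt).fderiv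
  have hdφ : DifferentiableAt ℝ (deriv φ) (w x) := by
    have : ContDiffAt ℝ 1 (deriv φ) (w x) := (hφ.fderiv_right (m := 1) (by norm_num)).clm_apply contDiffAt_const
    exact this.differentiableAt (by simp)
  have hdw : DifferentiableAt ℝ (fderiv ℝ w) x := by
    have : ContDiffAt ℝ 1 (fderiv ℝ w) x := hw.fderiv_right (by norm_num)
    exact this.differentiableAt (by simp)
  have h4 := (hdφ.hasDerivAt.comp_hasFDerivAt x (hw.differentiableAt (by simp)).hasFDerivAt).smul hdw.hasFDerivAt
  ext i j
  rw [hess_apply, h3.fderiv_eq]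
  erw [h4.fderiv]
  simp [hess_apply, gradc, Matrix.vecMulVec_apply]
  ring

theorem ext_zero {n : ℕ} {Ω K : Set (EuclideanSpace ℝ (Fin n))} (hΩ : IsOpen Ω) (hK : IsCompact K)
    (hKΩ : K ⊆ Ω) {f : EuclideanSpace ℝ (Fin n) → ℝ} (hf : ContDiffOn ℝ 2 f Ω)
    (h0 : ∀ x ∈ Ω, x ∉ K → f x = 0) :
    ContDiff ℝ 2 (Ω.indicator f) ∧ HasCompactSupport (Ω.indicator f) ∧
      (∀ x ∈ Ω, Ω.indicator f =ᶠ[nhds x] f) ∧ (∀ x ∉ K, Ω.indicator f =ᶠ[nhds x] fun _ => 0) := by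
  have hz : ∀ x ∉ K, Ω.indicator f x = 0 := by
    intro x hx
    by_cases h : x ∈ Ω
    · rw [indicator_of_mem h, h0 x h hx]
    · rw [indicator_of_notMem h]
  have h1 : ∀ x ∈ Ω, Ω.indicator f =ᶠ[nhds x] f := by
    intro x hx
    filter_upwards [hΩ.mem_nhds hx] with y hy
    rw [indicator_of_mem hy]
  have h2 : ∀ x ∉ K, Ω.indicator f =ᶠ[nhds x] fun _ => 0 := by
    intro x hx
    filter_upwards [hK.isClosed.isOpen_compl.mem_nhds hx] with y hy
    exact hz y hy
  refine ⟨?_, HasCompactSupport.intro hK hz, h1, h2⟩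
  rw [contDiff_iff_contDiffAt]
  intro x
  by_cases hx : x ∈ Ω
  · exact (hf.contDiffAt (hΩ.mem_nhds hx)).congr_of_eventuallyEq (h1 x hx)
  · exact contDiffAt_const.congr_of_eventuallyEq (h2 x fun h => hx (hKΩ h))

theorem exists_chi (δ : ℝ) (hδ : 0 < δ) : ∃ χ : ℝ → ℝ, ContDiff ℝ 2 χ ∧ (∀ s ≤ 0, χ s = 0) ∧
    (∀ s, deriv χ s ∈ Icc (0:ℝ) 1) ∧ (∀ s, 0 ≤ deriv (deriv χ) s) ∧
    (∀ s > δ, deriv χ s = 1 ∧ deriv (deriv χ) s = 0) := by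
  have hc : ContDiff ℝ 1 (fun t : ℝ => Real.smoothTransition (t / δ)) :=
    Real.smoothTransition.contDiff.comp (contDiff_id.div_const δ)
  have hd : ∀ s, HasDerivAt (fun s => ∫ t in (0:ℝ)..s, Real.smoothTransition (t / δ)) (Real.smoothTransition (s / δ)) s := by
    intro s
    exact intervalIntegral.integral_hasDerivAt_right (hc.continuous.intervalIntegrable _ _)
      (hc.continuous.stronglyMeasurableAtFilter _ _) hc.continuous.continuousAt
  have hde : deriv (fun s => ∫ t in (0:ℝ)..s, Real.smoothTransition (t / δ)) = fun t : ℝ => Real.smoothTransition (t / δ) :=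
    funext fun s => (hd s).deriv
  refine ⟨fun s => ∫ t in (0:ℝ)..s, Real.smoothTransition (t / δ), ?_, ?_, ?_, ?_, ?_⟩
  · rw [show (2 : WithTop ℕ∞) = 1 + 1 by norm_num, contDiff_succ_iff_deriv]
    refine ⟨fun s => (hd s).differentiableAt, by simp, ?_⟩
    rw [hde]; exact hc
  · intro s hs
    show ∫ t in (0:ℝ)..s, Real.smoothTransition (t / δ) = 0
    rw [intervalIntegral.integral_congr (g := fun _ => (0:ℝ))]
    · simp
    · intro t ht
      rw [uIcc_of_ge hs] at ht
      exact Real.smoothTransition.zero_of_nonpos (div_nonpos_of_nonpos_of_nonneg ht.2 hδ.le)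
  · intro s; rw [hde]
    exact ⟨Real.smoothTransition.nonneg _, Real.smoothTransition.le_one _⟩
  · intro s; rw [hde]
    refine Monotone.deriv_nonneg ?_
    intro a b hab
    exact Real.smoothTransition.monotone (by gcongr)
  · intro s hs
    rw [hde]
    refine ⟨Real.smoothTransition.one_of_one_le ((one_le_div hδ).mpr hs.le), ?_⟩
    have : (fun t : ℝ => Real.smoothTransition (t / δ)) =ᶠ[nhds s] fun _ => 1 := by
      filter_upwards [lt_mem_nhds hs] with t ht
      exact Real.smoothTransition.one_of_one_le ((one_le_div hδ).mpr ht.le)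
    rw [this.deriv_eq]; simp

theorem exists_tau (a b : ℝ) (hab : a < b) : ∃ τ : ℝ → ℝ, ContDiff ℝ 2 τ ∧ (∀ s ≤ a, τ s = s) ∧
    (∀ s ≥ b, τ s = 0) := by
  refine ⟨fun s => s * Real.smoothTransition ((b - s) / (b - a)), ?_, ?_, ?_⟩
  · exact contDiff_id.mul (Real.smoothTransition.contDiff.comp
      ((contDiff_const.sub contDiff_id).div_const _))
  · intro s hs
    have h : 0 < b - a := by linarith
    simp only
    rw [Real.smoothTransition.one_of_one_le ((one_le_div h).mpr (by linarith)), mul_one]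
  · intro s hs
    have h : 0 < b - a := by linarith
    simp only
    rw [Real.smoothTransition.zero_of_nonpos (div_nonpos_of_nonpos_of_nonneg (by linarith) h.le), mul_zero]

theorem q_grad {n : ℕ} (η : ℝ) (x0 x : EuclideanSpace ℝ (Fin n)) :
    fderiv ℝ (fun y => η ^ 2 + ‖y - x0‖ ^ 2) x = 2 • innerSL ℝ (x - x0) := by
  have h : HasFDerivAt (fun y : EuclideanSpace ℝ (Fin n) => η ^ 2 + ‖y - x0‖ ^ 2) (2 • innerSL ℝ (x - x0)) x := by
    have := ((hasFDerivAt_id x).sub_const x0).norm_sq.const_add (η ^ 2)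
    simpa using this
  exact h.fderiv

theorem q_hess {n : ℕ} (η : ℝ) (x0 x : EuclideanSpace ℝ (Fin n)) :
    hessianMatrix n (fun y => η ^ 2 + ‖y - x0‖ ^ 2) x = (2:ℝ) • 1 := by
  have h1 : fderiv ℝ (fun y : EuclideanSpace ℝ (Fin n) => η ^ 2 + ‖y - x0‖ ^ 2) = fun x => 2 • innerSL ℝ (x - x0) :=
    funext (q_grad η x0)
  ext i j
  rw [hess_apply, h1]
  have h2 : HasFDerivAt (fun y : EuclideanSpace ℝ (Fin n) => 2 • innerSL ℝ (y - x0)) (2 • innerSL ℝ) x :=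
    ((innerSL ℝ).hasFDerivAt.comp x ((hasFDerivAt_id x).sub_const x0)).const_smul 2
  rw [h2.fderiv]
  change (2 : ℕ) • inner ℝ (EuclideanSpace.single i (1:ℝ)) (EuclideanSpace.single j (1:ℝ)) = _
  by_cases hij : i = j <;> simp [hij, EuclideanSpace.inner_single_left]

theorem q_contDiff {n : ℕ} (η : ℝ) (x0 : EuclideanSpace ℝ (Fin n)) :
    ContDiff ℝ 2 (fun y => η ^ 2 + ‖y - x0‖ ^ 2) :=
  contDiff_const.add ((contDiff_id.sub contDiff_const).norm_sq ℝ)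

theorem v_contDiff {n : ℕ} (a p m η : ℝ) (hη : 0 < η) (x0 : EuclideanSpace ℝ (Fin n)) :
    ContDiff ℝ 2 (fun y => a * (η ^ 2 + ‖y - x0‖ ^ 2) ^ p - m) := by
  refine (contDiff_const.mul ((q_contDiff η x0).rpow_const_of_ne ?_)).sub contDiff_const
  intro x; positivity

theorem v_hess {n : ℕ} (a p m η : ℝ) (hη : 0 < η) (x0 x : EuclideanSpace ℝ (Fin n)) :
    hessianMatrix n (fun y => a * (η ^ 2 + ‖y - x0‖ ^ 2) ^ p - m) x =
      (2 * a * p * (η ^ 2 + ‖x - x0‖ ^ 2) ^ (p - 1)) •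
        (1 - (2 * (1 - p) / (η ^ 2 + ‖x - x0‖ ^ 2)) • Matrix.vecMulVec (x - x0) (x - x0)) := by
  have hq : 0 < η ^ 2 + ‖x - x0‖ ^ 2 := by positivity
  set φ : ℝ → ℝ := fun s => a * s ^ p - m with hφ
  have hd1 : ∀ s, 0 < s → HasDerivAt φ (a * (p * s ^ (p - 1))) s := fun s hs =>
    ((Real.hasDerivAt_rpow_const (Or.inl hs.ne')).const_mul a).sub_const m
  have hev : deriv φ =ᶠ[nhds (η ^ 2 + ‖x - x0‖ ^ 2)] fun s => a * (p * s ^ (p - 1)) := by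
    filter_upwards [lt_mem_nhds hq] with s hs
    exact (hd1 s hs).deriv
  have hd2 : HasDerivAt (fun s : ℝ => a * (p * s ^ (p - 1)))
      (a * (p * ((p - 1) * (η ^ 2 + ‖x - x0‖ ^ 2) ^ (p - 1 - 1)))) (η ^ 2 + ‖x - x0‖ ^ 2) :=
    ((Real.hasDerivAt_rpow_const (Or.inl hq.ne')).const_mul p).const_mul a
  have hφc : ContDiffAt ℝ 2 φ (η ^ 2 + ‖x - x0‖ ^ 2) :=
    (contDiffAt_const.mul (Real.contDiffAt_rpow_const_of_ne hq.ne')).sub contDiffAt_const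
  have h := hess_comp (w := fun y => η ^ 2 + ‖y - x0‖ ^ 2) (x := x) hφc (q_contDiff η x0).contDiffAt
  simp only at h
  rw [hev.deriv_eq, hd2.deriv, (hd1 _ hq).deriv, q_hess] at h
  change hessianMatrix n (fun y => φ (η ^ 2 + ‖y - x0‖ ^ 2)) x = _
  rw [h, Real.rpow_sub_one hq.ne' (p - 1)]
  have hg : ∀ i, gradc n (fun y => η ^ 2 + ‖y - x0‖ ^ 2) x i = 2 * (x i - x0 i) := by
    intro i
    simp only [gradc]
    rw [q_grad]
    simp [innerSL_apply_apply, EuclideanSpace.inner_single_right]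
  ext i j
  simp only [Matrix.add_apply, Matrix.smul_apply, Matrix.sub_apply, Matrix.vecMulVec_apply, hg, smul_eq_mul,
    PiLp.sub_apply]
  field_simp
  ring

theorem v_sgm {n k j : ℕ} (hj : 1 ≤ j) (hn : 1 ≤ n) (hk : 1 ≤ k) (a p m η : ℝ) (hη : 0 < η)
    (hp : 2 * (1 - p) = n / k) (x0 x : EuclideanSpace ℝ (Fin n)) :
    sgm n j (hessianMatrix n (fun y => a * (η ^ 2 + ‖y - x0‖ ^ 2) ^ p - m) x) =
      (2 * a * p * (η ^ 2 + ‖x - x0‖ ^ 2) ^ (p - 1)) ^ j * (n.choose j *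
        (1 - j / k * (‖x - x0‖ ^ 2 / (η ^ 2 + ‖x - x0‖ ^ 2)))) := by
  rw [v_hess _ _ _ _ hη, sgm_smul, sgm_rank1 n j hj hn, hp]
  congr 1
  have hq : 0 < η ^ 2 + ‖x - x0‖ ^ 2 := by positivity
  have h1 : ∑ i, (x - x0) i ^ 2 = ‖x - x0‖ ^ 2 := by
    rw [EuclideanSpace.norm_sq_eq]; simp
  have h2 : (n:ℝ) * (n-1).choose (j-1) = n.choose j * j := by
    obtain ⟨m, rfl⟩ : ∃ m, n = m + 1 := ⟨n - 1, by omega⟩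
    obtain ⟨l, rfl⟩ : ∃ l, j = l + 1 := ⟨j - 1, by omega⟩
    exact_mod_cast Nat.add_one_mul_choose_eq m l
  rw [h1]
  have hk0 : (k:ℝ) ≠ 0 := by positivity
  have : (n:ℝ) / k / (η ^ 2 + ‖x - x0‖ ^ 2) * ((n-1).choose (j-1) * ‖x - x0‖ ^ 2) =
    (n * (n-1).choose (j-1)) * ‖x - x0‖ ^ 2 / (k * (η ^ 2 + ‖x - x0‖ ^ 2)) := by
    field_simp
  rw [this, h2]
  field_simp


theorem v_Gam {n k : ℕ} (hn : 1 ≤ n) (hk : 1 ≤ k) (hkn : k ≤ n) (a p m η : ℝ) (hη : 0 < η) (ha : 0 < a) (hp0 : 0 < p)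
    (hp : 2 * (1 - p) = n / k) (x0 x : EuclideanSpace ℝ (Fin n)) :
    Gam n k (hessianMatrix n (fun y => a * (η ^ 2 + ‖y - x0‖ ^ 2) ^ p - m) x) := by
  refine ⟨hess_symm (v_contDiff a p m η hη x0).contDiffAt, fun j hj hjk => ?_⟩
  rw [v_sgm hj hn hk a p m η hη hp]
  have hq : 0 < η ^ 2 + ‖x - x0‖ ^ 2 := by positivity
  have hc : (0:ℝ) < n.choose j := by exact_mod_cast Nat.choose_pos (hjk.trans hkn)
  refine mul_pos (by positivity) (mul_pos hc ?_)
  have h1 : ‖x - x0‖ ^ 2 / (η ^ 2 + ‖x - x0‖ ^ 2) < 1 := by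
    rw [div_lt_one hq]; nlinarith
  have h2 : (j:ℝ) / k ≤ 1 := by
    have : (0:ℝ) < k := by exact_mod_cast hk
    rw [div_le_one this]; exact_mod_cast hjk
  have h3 : 0 ≤ ‖x - x0‖ ^ 2 / (η ^ 2 + ‖x - x0‖ ^ 2) := by positivity
  nlinarith

theorem v_lower {n k : ℕ} (hn : 1 ≤ n) (hk : 1 ≤ k) (a p m η : ℝ) (hη : 0 < η) (ha : 0 < a) (hp0 : 0 < p)
    (hp : 2 * (1 - p) = n / k) (x0 x : EuclideanSpace ℝ (Fin n)) (hx : x ∈ ball x0 η) :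
    (2 * a * p) ^ k * n.choose k * ((2:ℝ) ^ (-(n:ℝ)/2) / 2) * (η ^ n)⁻¹ ≤
      sgm n k (hessianMatrix n (fun y => a * (η ^ 2 + ‖y - x0‖ ^ 2) ^ p - m) x) := by
  rw [v_sgm hk hn hk a p m η hη hp]
  have hq : 0 < η ^ 2 + ‖x - x0‖ ^ 2 := by positivity
  have hk0 : (0:ℝ) < k := by exact_mod_cast hk
  have hx' : ‖x - x0‖ < η := by rwa [mem_ball, dist_eq_norm] at hx
  have hr : ‖x - x0‖ ^ 2 ≤ η ^ 2 := by gcongr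
  rw [mul_pow (2 * a * p), div_self hk0.ne', one_mul]
  have e1 : ((η ^ 2 + ‖x - x0‖ ^ 2) ^ (p - 1)) ^ k = (η ^ 2 + ‖x - x0‖ ^ 2) ^ (-(n:ℝ)/2) := by
    rw [← Real.rpow_natCast, ← Real.rpow_mul hq.le]
    congr 1
    rw [eq_div_iff hk0.ne'] at hp
    linarith
  have e2 : (2:ℝ) ^ (-(n:ℝ)/2) * (η ^ n)⁻¹ ≤ (η ^ 2 + ‖x - x0‖ ^ 2) ^ (-(n:ℝ)/2) := by
    have : (2:ℝ) ^ (-(n:ℝ)/2) * (η ^ n)⁻¹ = (2 * η ^ 2) ^ (-(n:ℝ)/2) := by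
      rw [Real.mul_rpow (by norm_num) (by positivity)]
      congr 1
      rw [← Real.rpow_natCast η 2, ← Real.rpow_mul hη.le, ← Real.rpow_natCast, ← Real.rpow_neg hη.le]
      congr 1
      push_cast; ring
    rw [this]
    refine Real.rpow_le_rpow_of_nonpos hq (by linarith) ?_
    have : (0:ℝ) ≤ n := by positivity
    linarith
  have e3 : (1:ℝ) / 2 ≤ 1 - ‖x - x0‖ ^ 2 / (η ^ 2 + ‖x - x0‖ ^ 2) := by
    have : ‖x - x0‖ ^ 2 / (η ^ 2 + ‖x - x0‖ ^ 2) ≤ 1 / 2 := by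
      rw [div_le_iff₀ hq]; linarith
    linarith
  rw [e1]
  calc (2 * a * p) ^ k * n.choose k * ((2:ℝ) ^ (-(n:ℝ)/2) / 2) * (η ^ n)⁻¹
      = (2 * a * p) ^ k * ((2:ℝ) ^ (-(n:ℝ)/2) * (η ^ n)⁻¹) * (n.choose k * (1 / 2)) := by ring
    _ ≤ _ := by gcongr

theorem main_ineq {n k : ℕ} (hk2 : 2 ≤ k) (hkn : k ≤ n) {d p : ℝ} (hd : 0 < d)
    (hp0 : 0 < p) (hp : 2 * (1 - p) = n / k) {Ω : Set (EuclideanSpace ℝ (Fin n))} (hΩ : IsOpen Ω)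
    (hb : Bornology.IsBounded Ω) (hdiam : Metric.diam Ω ≤ d) {u : EuclideanSpace ℝ (Fin n) → ℝ}
    (hu : IsStarSolution n k Ω u) {x0 : EuclideanSpace ℝ (Fin n)} (hx0 : x0 ∈ Ω)
    (hmin : ∀ x ∈ Ω, u x0 ≤ u x) {M : ℝ} (hM : M = - u x0) :
    (2 * (M / (4 * (2 * d ^ 2) ^ p)) * p) ^ k * n.choose k * ((2:ℝ) ^ (-(n:ℝ)/2) / 2) *
      volume.real (ball (0 : EuclideanSpace ℝ (Fin n)) 1) ≤ M / ((k:ℝ) - 1) * (volume Ω).toReal := by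
  obtain ⟨⟨huC, huc, hSk⟩, huneg, hubd, heq⟩ := hu
  have hn1 : 1 ≤ n := by omega
  have hk1 : 1 ≤ k := by omega
  have hM0 : 0 < M := by rw [hM]; linarith [huneg x0 hx0]
  have hkr : (0:ℝ) < (k:ℝ) - 1 := by
    have : (2:ℝ) ≤ k := by exact_mod_cast hk2
    linarith
  have huA : ∀ x ∈ Ω, ContDiffAt ℝ 2 u x := fun x hx => huC.contDiffAt (hΩ.mem_nhds hx)
  set a := M / (4 * (2 * d ^ 2) ^ p) with ha
  have h2d : 0 < (2 * d ^ 2) ^ p := by positivity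
  have ha0 : 0 < a := by positivity
  -- compact sublevel sets
  have hlev : ∀ c < 0, IsCompact {x | x ∈ closure Ω ∧ u x ≤ c} ∧ {x | x ∈ closure Ω ∧ u x ≤ c} ⊆ Ω := by
    intro c hc
    refine ⟨?_, ?_⟩
    · have : IsClosed (closure Ω ∩ u ⁻¹' Iic c) := huc.preimage_isClosed_of_isClosed isClosed_closure isClosed_Iic
      exact hb.isCompact_closure.of_isClosed_subset this (fun x hx => hx.1)
    · rintro x ⟨hx, hxc⟩
      by_contra hxn
      have : x ∈ frontier Ω := by
        rw [hΩ.frontier_eq]; exact ⟨hx, hxn⟩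
      have := hubd x this
      linarith
  -- radius
  obtain ⟨η, hη, hηd, hball⟩ : ∃ η > 0, η ≤ d ∧ ball x0 η ⊆ {x | x ∈ Ω ∧ u x < -(3 * M / 4)} := by
    have h1 : {x | x ∈ Ω ∧ u x < -(3 * M / 4)} ∈ nhds x0 := by
      have : ∀ᶠ x in nhds x0, u x < -(3 * M / 4) :=
        (huA x0 hx0).continuousAt.eventually (gt_mem_nhds (by linarith))
      filter_upwards [hΩ.mem_nhds hx0, this] with x h1 h2 using ⟨h1, h2⟩
    obtain ⟨ε, hε, hs⟩ := Metric.mem_nhds_iff.mp h1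
    exact ⟨min ε d, lt_min hε hd, min_le_right _ _, (ball_subset_ball (min_le_left _ _)).trans hs⟩
  set v : EuclideanSpace ℝ (Fin n) → ℝ := fun y => a * (η ^ 2 + ‖y - x0‖ ^ 2) ^ p - M / 2 with hv
  have hvC : ContDiff ℝ 2 v := v_contDiff a p (M / 2) η hη x0
  have hvle : ∀ x ∈ Ω, v x ≤ -(M / 4) := by
    intro x hx
    have h1 : ‖x - x0‖ ≤ d := by
      rw [← dist_eq_norm]; exact (dist_le_diam_of_mem hb hx hx0).trans hdiam
    have h2 : (η ^ 2 + ‖x - x0‖ ^ 2) ^ p ≤ (2 * d ^ 2) ^ p := by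
      refine Real.rpow_le_rpow (by positivity) ?_ hp0.le
      have : η ^ 2 ≤ d ^ 2 := by gcongr
      have : ‖x - x0‖ ^ 2 ≤ d ^ 2 := by gcongr
      linarith
    have h3 : a * (2 * d ^ 2) ^ p = M / 4 := by
      rw [ha]; field_simp
    have h4 : a * (η ^ 2 + ‖x - x0‖ ^ 2) ^ p ≤ a * (2 * d ^ 2) ^ p := by gcongr
    simp only [hv]; linarith
  have hvge : ∀ x, -(M / 2) ≤ v x := by
    intro x
    have : 0 ≤ a * (η ^ 2 + ‖x - x0‖ ^ 2) ^ p := by positivity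
    simp only [hv]; linarith
  obtain ⟨χ, hχC, hχ0, hχ1, hχ2, hχ3⟩ := exists_chi (M / 4) (by positivity)
  obtain ⟨τ, hτC, hτ1, hτ2⟩ := exists_tau (-(M / 6)) (-(M / 8)) (by linarith)
  obtain ⟨hK1, hK1Ω⟩ := hlev (-(M / 8)) (by linarith)
  obtain ⟨hK2, hK2Ω⟩ := hlev (-(M / 4)) (by linarith)
  set K := {x | x ∈ closure Ω ∧ u x ≤ -(M / 4)} with hKdef
  have hzC : ContDiffOn ℝ 2 (fun x => v x - u x) Ω := hvC.contDiffOn.sub huC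
  obtain ⟨hUC, hUc, hU1, hU2⟩ := ext_zero hΩ hK1 hK1Ω (f := fun x => τ (u x)) (hτC.comp_contDiffOn huC) (by
    intro x hx hxK
    refine hτ2 _ ?_
    by_contra h
    exact hxK ⟨subset_closure hx, (not_le.mp h).le⟩)
  obtain ⟨hPC, hPc, hP1, hP2⟩ := ext_zero hΩ hK2 hK2Ω (f := fun x => χ (v x - u x)) (hχC.comp_contDiffOn hzC) (by
    intro x hx hxK
    refine hχ0 _ ?_
    by_contra h
    exact hxK ⟨subset_closure hx, by linarith [hvle x hx]⟩)
  set U := Ω.indicator fun x => τ (u x) with hUdef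
  set P := Ω.indicator fun x => χ (v x - u x) with hPdef
  have hWC : ContDiff ℝ 2 (fun x => U x + P x) := hUC.add hPC
  have hWc : HasCompactSupport (fun x => U x + P x) := hUc.add hPc
  have I1 := null_lagr hk1 hkn hUC hUc
  have I2 := null_lagr hk1 hkn hWC hWc
  -- integrability
  have hint : ∀ f : EuclideanSpace ℝ (Fin n) → ℝ, ContDiff ℝ 2 f → HasCompactSupport f →
      Integrable (fun x => SkHess n k f x) := by
    intro f hf hfc
    have hc : Continuous fun x => SkHess n k f x := (sgm_continuous n k).comp (hess_continuous hf)
    refine hc.integrable_of_hasCompactSupport (HasCompactSupport.intro hfc.isCompact ?_)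
    intro x hx
    have h0 : f =ᶠ[nhds x] fun _ => 0 := notMem_tsupport_iff_eventuallyEq.mp hx
    have h1 : hessianMatrix n f x = 0 := by
      rw [hess_congr h0]
      ext i j
      rw [hess_apply]; simp
    have := sgm_smul n k (0:ℝ) 0
    rw [zero_smul, zero_pow (by omega), zero_mul] at this
    rw [SkHess, sgm_real, h1, this]
  have hGu : ∀ x ∈ Ω, Gam n k (hessianMatrix n u x) := fun x hx =>
    ⟨hess_symm (huA x hx), fun j hj hjk => hSk j hj hjk x hx⟩
  -- Hessians on K
  have hUK : ∀ x ∈ K, hessianMatrix n U x = hessianMatrix n u x := by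
    intro x hx
    refine hess_congr ?_
    have h1 : ∀ᶠ y in nhds x, u y < -(M / 6) :=
      (huA x (hK2Ω hx)).continuousAt.eventually (gt_mem_nhds (by linarith [hx.2]))
    filter_upwards [hU1 x (hK2Ω hx), h1] with y hy1 hy2
    rw [hy1]; exact hτ1 _ hy2.le
  have hWK : ∀ x ∈ K, hessianMatrix n (fun x => U x + P x) x =
      (1 - deriv χ (v x - u x)) • hessianMatrix n u x + deriv χ (v x - u x) • hessianMatrix n v x +
        deriv (deriv χ) (v x - u x) • Matrix.vecMulVec (gradc n (fun x => v x - u x) x) (gradc n (fun x => v x - u x) x) := by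
    intro x hx
    have hxΩ := hK2Ω hx
    rw [hess_add hUC.contDiffAt hPC.contDiffAt, hUK x hx, hess_congr (hP1 x hxΩ),
      hess_comp (w := fun x => v x - u x) hχC.contDiffAt (hvC.contDiffAt.sub (huA x hxΩ)),
      hess_sub hvC.contDiffAt (huA x hxΩ)]
    module
  have hvG : ∀ x, Gam n k (hessianMatrix n v x) := fun x =>
    v_Gam hn1 hk1 hkn a p (M / 2) η hη ha0 hp0 hp x0 x
  set c := (2 * a * p) ^ k * n.choose k * ((2:ℝ) ^ (-(n:ℝ)/2) / 2) * (η ^ n)⁻¹ with hc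
  have hSu : ∀ x ∈ Ω, sgm n k (hessianMatrix n u x) ≤ M / ((k:ℝ) - 1) := by
    intro x hx
    have := heq x hx
    rw [SkHess, sgm_real] at this
    rw [this]
    gcongr
    linarith [hmin x hx]
  have hballK : ball x0 η ⊆ K := fun x hx =>
    ⟨subset_closure (hball hx).1, by linarith [(hball hx).2]⟩
  have hD : ∀ x, Ω.indicator (fun _ => -(M / ((k:ℝ) - 1))) x + (ball x0 η).indicator (fun _ => c) x ≤
      SkHess n k (fun x => U x + P x) x - SkHess n k U x := by
    intro x
    by_cases hxK : x ∈ K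
    · have hxΩ := hK2Ω hxK
      rw [indicator_of_mem hxΩ, SkHess, SkHess, sgm_real, sgm_real, hUK x hxK, hWK x hxK]
      have h1 := hSu x hxΩ
      by_cases hxB : x ∈ ball x0 η
      · rw [indicator_of_mem hxB]
        have h2 := hχ3 (v x - u x) (by linarith [hvge x, (hball hxB).2])
        rw [h2.1, h2.2]
        have h3 := v_lower hn1 hk1 a p (M / 2) η hη ha0 hp0 hp x0 x hxB
        simp only [sub_self, zero_smul, zero_add, one_smul, add_zero]
        linarith
      · rw [indicator_of_notMem hxB]
        have hps : (deriv (deriv χ) (v x - u x) • Matrix.vecMulVec (gradc n (fun x => v x - u x) x) (gradc n (fun x => v x - u x) x) : Matrix (Fin n) (Fin n) ℝ).PosSemidef := by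
          refine Matrix.PosSemidef.smul ?_ (hχ2 _)
          have := Matrix.posSemidef_vecMulVec_self_star (gradc n (fun x => v x - u x) x : Fin n → ℝ)
          simpa using this
        have h2 := garding_final hkn (hGu x hxΩ) (hvG x) hps (hχ1 (v x - u x))
        linarith
    · have hxB : x ∉ ball x0 η := fun h => hxK (hballK h)
      have h1 : hessianMatrix n (fun x => U x + P x) x = hessianMatrix n U x := by
        refine hess_congr ?_
        filter_upwards [hP2 x hxK] with y hy
        rw [hy, add_zero]
      rw [SkHess, SkHess, h1, sub_self, indicator_of_notMem hxB, add_zero]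
      refine indicator_nonpos (fun _ _ => ?_) x
      have : 0 ≤ M / ((k:ℝ) - 1) := by positivity
      linarith
  have hΩf : volume Ω ≠ ⊤ := hb.measure_lt_top.ne
  have hBf : volume (ball x0 η) ≠ ⊤ := measure_ball_lt_top.ne
  have i1 : Integrable (Ω.indicator (fun _ => -(M / ((k:ℝ) - 1)))) volume :=
    (integrable_indicator_iff hΩ.measurableSet).mpr (integrableOn_const hΩf)
  have i2 : Integrable ((ball x0 η).indicator (fun _ => c)) volume :=
    (integrable_indicator_iff measurableSet_ball).mpr (integrableOn_const hBf)
  have hmono := integral_mono (i1.add i2) ((hint _ hWC hWc).sub (hint _ hUC hUc)) hD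
  rw [integral_sub' (hint _ hWC hWc) (hint _ hUC hUc), I1, I2, integral_add' i1 i2,
    integral_indicator hΩ.measurableSet, integral_indicator measurableSet_ball,
    setIntegral_const, setIntegral_const, smul_eq_mul, smul_eq_mul] at hmono
  have hvolB : volume.real (ball x0 η) = η ^ n * volume.real (ball (0 : EuclideanSpace ℝ (Fin n)) 1) := by
    rw [Measure.real, Measure.addHaar_ball_of_pos volume x0 hη, ENNReal.toReal_mul, ENNReal.toReal_ofReal (by positivity)]
    simp [Measure.real]
  rw [hvolB] at hmono
  have : η ^ n * volume.real (ball (0 : EuclideanSpace ℝ (Fin n)) 1) * c = (2 * a * p) ^ k * n.choose k * ((2:ℝ) ^ (-(n:ℝ)/2) / 2) *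
      volume.real (ball (0 : EuclideanSpace ℝ (Fin n)) 1) := by
    rw [hc]; field_simp
  rw [this] at hmono
  have e : volume.real Ω = (volume Ω).toReal := rfl
  rw [e] at hmono
  linarith


/-- for `n/2 < k ≤ n`, `k ≥ 2`, there is a constant `C > 0` depending only on
`n`, `k` and a bound `d` on the diameter, such that every solution `θ` of problem (★) on a
bounded open `Ω` with `diam(Ω) ≤ d` satisfies `sup_Ω |θ| ≤ C (vol(Ω)/(k-1))^{1/(k-1)}`. -/
theorem stmt_4 (n k : ℕ) (hn : 2 ≤ n) (hk2 : 2 ≤ k) (hkn : k ≤ n) (hnk : n < 2 * k)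
    (d : ℝ) (hd : 0 < d) :
    ∃ C : ℝ, 0 < C ∧
      ∀ Ω : Set (EuclideanSpace ℝ (Fin n)), IsOpen Ω → Bornology.IsBounded Ω →
        Metric.diam Ω ≤ d →
        ∀ θ : EuclideanSpace ℝ (Fin n) → ℝ, IsStarSolution n k Ω θ →
          supAbs n Ω θ ≤
            C * ((volume Ω).toReal / ((k : ℝ) - 1)) ^ ((1 : ℝ) / ((k : ℝ) - 1)) := by
  have hn1 : 1 ≤ n := by omega
  have hk1 : 1 ≤ k := by omega
  have hk0 : (0:ℝ) < k := by exact_mod_cast hk1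
  have hkr : (0:ℝ) < (k:ℝ) - 1 := by
    have : (2:ℝ) ≤ k := by exact_mod_cast hk2
    linarith
  obtain ⟨p, hp⟩ : ∃ p : ℝ, 2 * (1 - p) = n / k := ⟨1 - n / k / 2, by ring⟩
  have hp0 : 0 < p := by
    have : (n:ℝ) / k < 2 := by
      rw [div_lt_iff₀ hk0]; exact_mod_cast hnk
    linarith
  set κ : ℝ := (2 * (1 / (4 * (2 * d ^ 2) ^ p)) * p) ^ k * n.choose k * ((2:ℝ) ^ (-(n:ℝ)/2) / 2) *
      volume.real (ball (0 : EuclideanSpace ℝ (Fin n)) 1) with hκ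
  have hκ0 : 0 < κ := by
    have h1 : (0:ℝ) < n.choose k := by exact_mod_cast Nat.choose_pos hkn
    have h2 : 0 < volume.real (ball (0 : EuclideanSpace ℝ (Fin n)) 1) :=
      ENNReal.toReal_pos (measure_ball_pos _ _ one_pos).ne' measure_ball_lt_top.ne
    have h3 : 0 < (2 * d ^ 2) ^ p := by positivity
    positivity
  refine ⟨κ⁻¹ ^ ((1 : ℝ) / ((k : ℝ) - 1)), by positivity, ?_⟩
  intro Ω hΩ hb hdiam θ hθ
  have hY : 0 ≤ (volume Ω).toReal / ((k : ℝ) - 1) := by positivity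
  rcases Ω.eq_empty_or_nonempty with rfl | hne
  · have : supAbs n ∅ θ = 0 := by simp [supAbs]
    rw [this]
    positivity
  obtain ⟨x0, hx0c, hmin⟩ := hb.isCompact_closure.exists_isMinOn hne.closure hθ.1.2.1
  have hmin' : ∀ x ∈ Ω, θ x0 ≤ θ x := fun x hx => hmin (subset_closure hx)
  have hx0 : x0 ∈ Ω := by
    by_contra hxn
    have h1 : x0 ∈ frontier Ω := by
      rw [hΩ.frontier_eq]; exact ⟨hx0c, hxn⟩
    have h2 := hθ.2.2.1 x0 h1
    obtain ⟨y, hy⟩ := hne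
    linarith [hmin' y hy, hθ.2.1 y hy]
  set M := -θ x0 with hM
  have hM0 : 0 < M := by linarith [hθ.2.1 x0 hx0]
  have hmain := main_ineq hk2 hkn hd hp0 hp hΩ hb hdiam hθ hx0 hmin' hM
  have hsup : supAbs n Ω θ ≤ M := by
    refine csSup_le (hne.image _) ?_
    rintro _ ⟨x, hx, rfl⟩
    simp only
    rw [abs_of_neg (hθ.2.1 x hx)]
    linarith [hmin' x hx]
  refine hsup.trans ?_
  obtain ⟨m, rfl⟩ : ∃ m, k = m + 1 := ⟨k - 1, by omega⟩
  have h1 : κ * M ^ m * M ≤ (volume Ω).toReal / (((m + 1 : ℕ) : ℝ) - 1) * M := by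
    refine le_trans (le_of_eq ?_) (hmain.trans (le_of_eq ?_))
    · rw [hκ]
      rw [show 2 * (M / (4 * (2 * d ^ 2) ^ p)) * p = (2 * (1 / (4 * (2 * d ^ 2) ^ p)) * p) * M by ring,
        mul_pow _ M, pow_succ M]
      ring
    · ring
  have h2 : κ * M ^ m ≤ (volume Ω).toReal / (((m + 1 : ℕ) : ℝ) - 1) := le_of_mul_le_mul_right h1 hM0
  have h3 : M ^ m ≤ κ⁻¹ * ((volume Ω).toReal / (((m + 1 : ℕ) : ℝ) - 1)) := by
    rw [inv_mul_eq_div, le_div_iff₀ hκ0]; linarith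
  rw [← Real.mul_rpow (by positivity) hY]
  have hmm : (((m + 1 : ℕ) : ℝ) - 1) = m := by push_cast; ring
  have hm0 : (m:ℝ) ≠ 0 := by
    have : 1 ≤ m := by omega
    positivity
  have h4 : M = (M ^ m) ^ ((1 : ℝ) / (((m + 1 : ℕ) : ℝ) - 1)) := by
    rw [hmm, ← Real.rpow_natCast, ← Real.rpow_mul hM0.le, mul_one_div_cancel hm0, Real.rpow_one]
  calc M = (M ^ m) ^ ((1 : ℝ) / (((m + 1 : ℕ) : ℝ) - 1)) := h4
    _ ≤ _ := Real.rpow_le_rpow (by positivity) h3 (by positivity)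
end
end

section
/- Let n ≥ 2, let k be an integer with 2 ≤ k ≤ n, and let Ω ⊆ ℝⁿ be a bounded open set. Let θ be a solution of problem (★) on Ω and let e ∈ C²(Ω) ∩ C(Ω̄) be k-admissible on Ω with e < 0 in Ω, S_k(D²e) = 1 in Ω and e = 0 on ∂Ω. Then, with c = (sup_Ω |θ| / (k−1))^{1/k}, one has θ ≥ c·e on Ω̄; consequently sup_Ω |θ| ≤ c · sup_Ω |e|, i.e. sup_Ω |θ| ≤ (k−1)^{-1/(k-1)} (sup_Ω |e|)^{k/(k-1)}. -/
open scoped BigOperators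
open Metric Set MeasureTheory Filter

noncomputable section

section Alg
open Polynomial

lemma aux_laguerre (m : Multiset ℝ) (a x : ℝ) :
    (C a * (m.map fun r => X - C r).prod).eval x *
      (derivative (derivative (C a * (m.map fun r => X - C r).prod))).eval x ≤
      ((derivative (C a * (m.map fun r => X - C r).prod)).eval x) ^ 2 := by
  induction m using Multiset.induction_on with
  | empty => simp
  | cons r m ih =>
    have h : C a * ((r ::ₘ m).map fun r => X - C r).prod
        = (X - C r) * (C a * (m.map fun r => X - C r).prod) := by
      rw [Multiset.map_cons, Multiset.prod_cons]; ring
    rw [h]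
    generalize C a * (m.map fun r => X - C r).prod = g at *
    simp only [derivative_mul, derivative_sub, derivative_X, derivative_C, derivative_add,
      eval_mul, eval_add, eval_sub, eval_X, eval_C, sub_zero, one_mul]
    nlinarith [sq_nonneg (eval x g), mul_nonneg (sq_nonneg (x - r)) (sub_nonneg.2 ih)]

lemma aux_laguerre' (f : ℝ[X]) (hf : f.Splits) (x : ℝ) :
    f.eval x * (derivative (derivative f)).eval x ≤ ((derivative f).eval x) ^ 2 := by
  have := aux_laguerre f.roots f.leadingCoeff x
  rwa [← hf.eq_prod_roots] at this

lemma aux_splits_derivative (f : ℝ[X]) (hf : f.Splits) : (derivative f).Splits := by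
  by_cases h0 : f.natDegree = 0
  · rw [natDegree_eq_zero] at h0
    obtain ⟨c, rfl⟩ := h0
    simp
  rw [splits_iff_card_roots]
  have h1 := splits_iff_card_roots.1 hf
  have h2 := card_roots_le_derivative f
  have h3 := natDegree_derivative_lt h0
  have h4 := card_roots' (derivative f)
  omega

lemma aux_splits_iterate (f : ℝ[X]) (hf : f.Splits) (m : ℕ) : (derivative^[m] f).Splits := by
  induction m with
  | zero => simpa
  | succ m ih => rw [Function.iterate_succ_apply']; exact aux_splits_derivative _ ih

lemma aux_newton (f : ℝ[X]) (hf : f.Splits) (m : ℕ) :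
    f.coeff m * f.coeff (m + 2) ≤ f.coeff (m + 1) ^ 2 := by
  have h := aux_laguerre' _ (aux_splits_iterate f hf m) 0
  simp only [← Function.iterate_succ_apply' (f := derivative)] at h
  simp only [← coeff_zero_eq_eval_zero, coeff_iterate_derivative, zero_add,
    Nat.descFactorial_self, nsmul_eq_mul] at h
  have e1 : ((m + 1).factorial : ℝ) = (m + 1) * m.factorial := by
    rw [Nat.factorial_succ]; push_cast; ring
  have e2 : ((m + 1 + 1).factorial : ℝ) = (m + 2) * ((m + 1) * m.factorial) := by
    rw [Nat.factorial_succ, Nat.factorial_succ]; push_cast; ring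
  simp only [Nat.succ_eq_add_one] at h
  rw [e2, e1] at h
  have hp : (0 : ℝ) < m.factorial := by exact_mod_cast Nat.factorial_pos m
  have h' : ((m : ℝ) + 2) * (f.coeff m * f.coeff (m + 2)) ≤ (m + 1) * f.coeff (m + 1) ^ 2 := by
    have hq : (0 : ℝ) < m.factorial ^ 2 * (m + 1) := by positivity
    refine le_of_mul_le_mul_left ?_ hq
    calc _ = _ := ?_
      _ ≤ _ := h
      _ = _ := by ring
    ring
  have hm : (0 : ℝ) ≤ m := by positivity
  by_contra hc
  push Not at hc
  nlinarith [sq_nonneg (f.coeff (m + 1))]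

/-- The polynomial `det (1 + X M)`. -/
def auxF {n : ℕ} (M : Matrix (Fin n) (Fin n) ℝ) : ℝ[X] := (1 + (X : ℝ[X]) • M.map C).det

lemma auxF_coeff {n : ℕ} (M : Matrix (Fin n) (Fin n) ℝ) (k : ℕ) :
    (auxF M).coeff k = sumPrincipalMinors n k M :=
  Matrix.coeff_det_one_add_X_smul_eq_sum_minors M k

lemma auxF_eval {n : ℕ} (M : Matrix (Fin n) (Fin n) ℝ) (t : ℝ) :
    (auxF M).eval t = (1 + t • M).det := by
  unfold auxF
  rw [← coe_evalRingHom, RingHom.map_det]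
  congr 1
  ext i j
  by_cases h : i = j
  · subst h; simp; ring
  · simp [h]; ring

lemma auxF_conj {n : ℕ} (U V M : Matrix (Fin n) (Fin n) ℝ) (h : V * U = 1) :
    auxF (U * M * V) = auxF M := by
  have h' : U * V = 1 := mul_eq_one_comm.1 h
  apply Polynomial.funext
  intro t
  rw [auxF_eval, auxF_eval]
  have : (1 : Matrix (Fin n) (Fin n) ℝ) + t • (U * M * V) = U * (1 + t • M) * V := by
    rw [mul_add, add_mul, mul_one, h']; simp
  rw [this, Matrix.det_mul, Matrix.det_mul, mul_comm, ← mul_assoc, ← Matrix.det_mul, h]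
  simp

lemma auxF_diag {n : ℕ} (d : Fin n → ℝ) :
    auxF (Matrix.diagonal d) = ∏ i, (1 + C (d i) * X) := by
  apply Polynomial.funext
  intro t
  rw [auxF_eval, eval_prod, ← Matrix.diagonal_one, ← Matrix.diagonal_smul, Matrix.diagonal_add,
    Matrix.det_diagonal]
  apply Finset.prod_congr rfl
  intro i _
  simp only [Pi.smul_apply, smul_eq_mul, eval_add, eval_one, eval_mul, eval_C, eval_X]
  ring

lemma auxF_rank {n : ℕ} (d w : Fin n → ℝ) :
    auxF (Matrix.diagonal d + Matrix.vecMulVec w w) =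
      (∏ i, (1 + C (d i) * X)) +
        X * ∑ i, C (w i ^ 2) * ∏ l ∈ Finset.univ.erase i, (1 + C (d l) * X) := by
  set E : ℝ[X] := ∏ i, (1 + C (d i) * X) with hE
  have hE0 : E ≠ 0 := by
    intro h
    have := congrArg (eval 0) h
    simp [hE, eval_prod] at this
  refine Polynomial.eq_of_infinite_eval_eq _ _ (Set.Infinite.mono (s := {t | ¬ E.IsRoot t}) ?_ ?_)
  · intro t ht
    have ht' : ∏ i, (1 + d i * t) ≠ 0 := by
      simpa [hE, IsRoot, eval_prod] using ht
    have hti : ∀ i, 1 + d i * t ≠ 0 := fun i => by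
      rw [Finset.prod_ne_zero_iff] at ht'; exact ht' i (Finset.mem_univ i)
    change eval t _ = eval t _
    rw [auxF_eval]
    have e1 : (1 : Matrix (Fin n) (Fin n) ℝ) + t • (Matrix.diagonal d + Matrix.vecMulVec w w)
        = Matrix.diagonal (fun i => 1 + d i * t) +
          Matrix.replicateCol Unit (t • w) * Matrix.replicateRow Unit w := by
      rw [← Matrix.vecMulVec_eq]
      ext i j
      by_cases h : i = j
      · subst h; simp [Matrix.vecMulVec_apply]; ring
      · simp [Matrix.vecMulVec_apply, h, mul_assoc]
    rw [e1, Matrix.det_add_replicateCol_mul_replicateRow (by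
      rw [Matrix.det_diagonal]; exact ht'.isUnit), Matrix.det_diagonal]
    have e2 : (Matrix.diagonal (fun i => 1 + d i * t))⁻¹
        = Matrix.diagonal (fun i => (1 + d i * t)⁻¹) := by
      apply Matrix.inv_eq_right_inv
      rw [Matrix.diagonal_mul_diagonal, ← Matrix.diagonal_one]
      congr 1; ext i; exact mul_inv_cancel₀ (hti i)
    rw [e2, Matrix.det_unique]
    have e3 : ((1 : Matrix Unit Unit ℝ) + Matrix.replicateRow Unit w *
        Matrix.diagonal (fun i => (1 + d i * t)⁻¹) *
        Matrix.replicateCol Unit (t • w)) default default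
        = 1 + t * ∑ i, w i ^ 2 * (1 + d i * t)⁻¹ := by
      rw [Matrix.add_apply, Matrix.mul_apply]
      simp [Matrix.mul_diagonal, Finset.mul_sum]
      apply Finset.sum_congr rfl; intro i _; ring
    rw [e3, mul_add, mul_one]
    simp only [eval_add, eval_mul, eval_X, eval_finset_sum, eval_C, eval_prod, hE, eval_one]
    congr 1
    rw [Finset.mul_sum, Finset.mul_sum, Finset.mul_sum]
    apply Finset.sum_congr rfl; intro i _
    rw [← Finset.mul_prod_erase Finset.univ (fun i => 1 + d i * t) (Finset.mem_univ i)]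
    field_simp [hti i]
  · have : {t | E.IsRoot t}.Finite := by
      exact Polynomial.finite_setOfPred_isRoot hE0
    exact this.infinite_compl

lemma aux_coeff_pos {n : ℕ} (d : Fin n → ℝ) (i : Fin n) (k : ℕ)
    (h : ∀ j, 1 ≤ j → j ≤ k → 0 < (∏ i, (1 + C (d i) * X) : ℝ[X]).coeff j) (j : ℕ)
    (hj : j + 1 ≤ k) :
    0 < (∏ l ∈ Finset.univ.erase i, (1 + C (d l) * X) : ℝ[X]).coeff j := by
  set G : ℝ[X] := ∏ l ∈ Finset.univ.erase i, (1 + C (d l) * X) with hG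
  have hE : (∏ i, (1 + C (d i) * X) : ℝ[X]) = (1 + C (d i) * X) * G :=
    (Finset.mul_prod_erase Finset.univ (fun i => (1 + C (d i) * X : ℝ[X]))
      (Finset.mem_univ i)).symm
  rw [hE] at h
  have hs : G.Splits := Splits.prod fun l _ => Splits.of_natDegree_le_one (by compute_degree)
  have hc : ∀ j, ((1 + C (d i) * X) * G).coeff (j + 1) = G.coeff (j + 1) + d i * G.coeff j := by
    intro j
    rw [add_mul, one_mul, mul_assoc, coeff_add, coeff_C_mul, coeff_X_mul]
  induction j with
  | zero => simp [hG, coeff_zero_eq_eval_zero, eval_prod]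
  | succ j ih =>
    have ih := ih (by omega)
    have h1 := h (j + 1) (by omega) (by omega)
    have h2 := h (j + 2) (by omega) (by omega)
    rw [hc] at h1 h2
    have hN := aux_newton G hs j
    by_contra hneg
    push Not at hneg
    nlinarith [mul_pos ih h2, mul_nonneg (sub_nonneg.2 hneg) h1.le]

lemma aux_rank_one_mono {n : ℕ} (B : Matrix (Fin n) (Fin n) ℝ) (hB : B.IsHermitian)
    (v : Fin n → ℝ) (k : ℕ)
    (h : ∀ j, 1 ≤ j → j ≤ k → 0 < sumPrincipalMinors n j B) (j : ℕ) (hj1 : 1 ≤ j) (hj : j ≤ k) :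
    sumPrincipalMinors n j B ≤ sumPrincipalMinors n j (B + Matrix.vecMulVec v v) := by
  obtain ⟨U, d, hU, hBd⟩ : ∃ (U : Matrix (Fin n) (Fin n) ℝ) (d : Fin n → ℝ),
      U.transpose * U = 1 ∧ B = U * Matrix.diagonal d * U.transpose := by
    refine ⟨hB.eigenvectorUnitary, hB.eigenvalues, ?_, ?_⟩
    · have := Unitary.coe_star_mul_self hB.eigenvectorUnitary
      simpa [Matrix.star_eq_conjTranspose] using this
    · have := hB.spectral_theorem
      rw [Unitary.conjStarAlgAut_apply] at this
      conv_lhs => rw [this]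
      simp [Matrix.star_eq_conjTranspose]
  have hU' : U * U.transpose = 1 := mul_eq_one_comm.1 hU
  set w := U.transpose.mulVec v with hw
  have e : B + Matrix.vecMulVec v v
      = U * (Matrix.diagonal d + Matrix.vecMulVec w w) * U.transpose := by
    rw [mul_add, add_mul, ← hBd, Matrix.mul_vecMulVec, Matrix.vecMulVec_mul, hw,
      Matrix.mulVec_mulVec, hU', Matrix.one_mulVec, Matrix.vecMul_transpose,
      Matrix.mulVec_mulVec, hU', Matrix.one_mulVec]
  have hF1 : auxF B = ∏ i, (1 + C (d i) * X) := by
    rw [hBd, auxF_conj _ _ _ hU, auxF_diag]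
  have hF2 := auxF_rank d w
  rw [← auxF_conj U U.transpose _ hU, ← e] at hF2
  simp only [← auxF_coeff] at h ⊢
  rw [hF1] at h ⊢
  rw [hF2]
  obtain ⟨j, rfl⟩ : ∃ m, j = m + 1 := ⟨j - 1, by omega⟩
  rw [coeff_add, coeff_X_mul, finsetSum_coeff]
  simp only [coeff_C_mul]
  have : 0 ≤ ∑ i, w i ^ 2 * (∏ l ∈ Finset.univ.erase i, (1 + C (d l) * X) : ℝ[X]).coeff j :=
    Finset.sum_nonneg fun i _ => mul_nonneg (sq_nonneg _) (aux_coeff_pos d i k h j hj).le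
  linarith

lemma aux_mono {n : ℕ} (A B : Matrix (Fin n) (Fin n) ℝ) (hB : B.IsHermitian)
    (hAB : (A - B).PosSemidef) (k : ℕ) (hk : 1 ≤ k)
    (h : ∀ j, 1 ≤ j → j ≤ k → 0 < sumPrincipalMinors n j B) :
    sumPrincipalMinors n k B ≤ sumPrincipalMinors n k A := by
  obtain ⟨m, v, hv⟩ := Matrix.posSemidef_iff_eq_sum_vecMulVec.1 hAB
  have hA : A = B + ∑ i, Matrix.vecMulVec (v i) (v i) := by
    have : A = B + (A - B) := by abel
    rw [this, hv]; simp
  rw [hA]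
  have key : ∀ s : Finset (Fin m),
      (B + ∑ i ∈ s, Matrix.vecMulVec (v i) (v i)).IsHermitian ∧
      ∀ j, 1 ≤ j → j ≤ k → sumPrincipalMinors n j B ≤
        sumPrincipalMinors n j (B + ∑ i ∈ s, Matrix.vecMulVec (v i) (v i)) := by
    intro s
    induction s using Finset.induction_on with
    | empty => simpa using hB
    | insert a s ha ih =>
      have e : B + ∑ i ∈ insert a s, Matrix.vecMulVec (v i) (v i)
        = (B + ∑ i ∈ s, Matrix.vecMulVec (v i) (v i)) + Matrix.vecMulVec (v a) (v a) := by
        rw [Finset.sum_insert ha]; abel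
      rw [e]
      refine ⟨ih.1.add ?_, fun j h1 h2 => (ih.2 j h1 h2).trans ?_⟩
      · ext i j; simp [Matrix.vecMulVec_apply, mul_comm]
      · exact aux_rank_one_mono _ ih.1 (v a) k
          (fun j h1 h2 => (h j h1 h2).trans_le (ih.2 j h1 h2)) j h1 h2
  exact (key Finset.univ).2 k hk le_rfl

lemma aux_smul {n : ℕ} (c : ℝ) (A : Matrix (Fin n) (Fin n) ℝ) (k : ℕ) :
    sumPrincipalMinors n k (c • A) = c ^ k * sumPrincipalMinors n k A := by
  unfold sumPrincipalMinors
  rw [Finset.mul_sum]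
  apply Finset.sum_congr rfl
  intro s hs
  have e : (c • A).submatrix (fun i : {i // i ∈ s} => (i : Fin n)) (fun i : {i // i ∈ s} => (i : Fin n))
      = c • A.submatrix (fun i : {i // i ∈ s} => (i : Fin n)) (fun i : {i // i ∈ s} => (i : Fin n)) := rfl
  rw [e, Matrix.det_smul]
  simp [(Finset.mem_powersetCard.1 hs).2]

end Alg

section Ana
open Topology

lemma aux_second_deriv {E : Type*} [NormedAddCommGroup E] [NormedSpace ℝ E] (w : E → ℝ) (x v : E)
    (hw : ContDiffAt ℝ 2 w x) (hmin : IsLocalMin w x) :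
    0 ≤ fderiv ℝ (fderiv ℝ w) x v v := by
  by_contra hneg
  push Not at hneg
  set g : ℝ → ℝ := fun t => w (x + t • v) with hg
  have hline : ∀ t : ℝ, HasDerivAt (fun t : ℝ => x + t • v) v t := fun t => by
    simpa using ((hasDerivAt_id t).smul_const v).const_add x
  have hcont : Tendsto (fun t : ℝ => x + t • v) (𝓝 0) (𝓝 x) := by
    have := (hline 0).continuousAt.tendsto
    simpa using this
  have hd : ∀ᶠ y in 𝓝 x, DifferentiableAt ℝ w y := by
    have := hw.eventually (by simp)
    filter_upwards [this] with y hy using hy.differentiableAt (by simp)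
  have hd1 : ∀ᶠ t in 𝓝 (0 : ℝ), deriv g t = fderiv ℝ w (x + t • v) v := by
    filter_upwards [hcont.eventually hd] with t ht
    exact (ht.hasFDerivAt.comp_hasDerivAt t (hline t)).deriv
  have hf2 : DifferentiableAt ℝ (fderiv ℝ w) x :=
    (hw.fderiv_right (m := 1) (by norm_num)).differentiableAt (by simp)
  have hd2 : deriv (deriv g) 0 = fderiv ℝ (fderiv ℝ w) x v v := by
    rw [Filter.EventuallyEq.deriv_eq (f₁ := deriv g) hd1]
    have h0 : HasFDerivAt (fderiv ℝ w) (fderiv ℝ (fderiv ℝ w) x) (x + (0 : ℝ) • v) := by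
      simpa using hf2.hasFDerivAt
    have h1 : HasDerivAt (fun t : ℝ => fderiv ℝ w (x + t • v)) (fderiv ℝ (fderiv ℝ w) x v) 0 :=
      h0.comp_hasDerivAt (0 : ℝ) (hline 0)
    have h2 : HasDerivAt (fun t : ℝ => fderiv ℝ w (x + t • v) v)
        (fderiv ℝ (fderiv ℝ w) x v v) 0 := by
      have := (ContinuousLinearMap.apply ℝ ℝ v).hasFDerivAt.comp_hasDerivAt (0 : ℝ) h1
      exact this
    exact h2.deriv
  have hgmin : IsLocalMin g 0 := by
    have : ∀ᶠ t in 𝓝 (0 : ℝ), w x ≤ w (x + t • v) := hcont.eventually hmin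
    simpa [IsLocalMin, IsMinFilter, hg] using this
  have hgc : ContinuousAt g 0 := by
    have h0 : ContinuousAt w (x + (0 : ℝ) • v) := by simpa using hw.continuousAt
    exact ContinuousAt.comp (f := fun t : ℝ => x + t • v) h0 (hline 0).continuousAt
  have hgmax := isLocalMax_of_deriv_deriv_neg (hd2 ▸ hneg) hgmin.deriv_eq_zero hgc
  have hconst : g =ᶠ[𝓝 0] fun _ => g 0 := by
    filter_upwards [hgmin, hgmax] with t h1 h2 using le_antisymm h2 h1
  have h2 : deriv g =ᶠ[𝓝 0] fun _ => 0 := by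
    filter_upwards [hconst.eventuallyEq_nhds] with t ht
    rw [ht.deriv_eq]; simp
  have h3 : deriv (deriv g) 0 = 0 := by rw [h2.deriv_eq]; simp
  rw [hd2] at h3
  linarith

lemma aux_hess_herm {n : ℕ} (u : EuclideanSpace ℝ (Fin n) → ℝ) (x : EuclideanSpace ℝ (Fin n))
    (hu : ContDiffAt ℝ 2 u x) : (hessianMatrix n u x).IsHermitian := by
  ext i j
  simp only [hessianMatrix, Matrix.conjTranspose_apply, Matrix.of_apply, iteratedFDeriv_two_apply]
  exact (hu.isSymmSndFDerivAt (by simp)) _ _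

lemma aux_hess_psd {n : ℕ} (u : EuclideanSpace ℝ (Fin n) → ℝ) (x : EuclideanSpace ℝ (Fin n))
    (hu : ContDiffAt ℝ 2 u x) (hmin : IsLocalMin u x) : (hessianMatrix n u x).PosSemidef := by
  refine Matrix.PosSemidef.of_dotProduct_mulVec_nonneg (aux_hess_herm u x hu) fun v => ?_
  have h := aux_second_deriv u x (∑ i, v i • EuclideanSpace.single i (1 : ℝ)) hu hmin
  simp only [map_sum, map_smul, ContinuousLinearMap.sum_apply, ContinuousLinearMap.smul_apply,
    smul_eq_mul] at h
  refine h.trans_eq (Eq.symm ?_)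
  change ∑ i, v i * ∑ j, iteratedFDeriv ℝ 2 u x ![EuclideanSpace.single i (1 : ℝ),
    EuclideanSpace.single j (1 : ℝ)] * v j = _
  simp only [iteratedFDeriv_two_apply, Finset.mul_sum]
  rw [Finset.sum_comm]
  refine Finset.sum_congr rfl fun i _ => Finset.sum_congr rfl fun j _ => ?_
  simp
  ring

lemma aux_hess_sub {n : ℕ} (u e : EuclideanSpace ℝ (Fin n) → ℝ) (c : ℝ)
    (x : EuclideanSpace ℝ (Fin n))
    (hu : ContDiffAt ℝ 2 u x) (he : ContDiffAt ℝ 2 e x) :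
    hessianMatrix n (u - c • e) x = hessianMatrix n u x - c • hessianMatrix n e x := by
  ext i j
  simp only [hessianMatrix, Matrix.of_apply, Matrix.sub_apply, Matrix.smul_apply]
  rw [iteratedFDeriv_sub_apply (by exact_mod_cast hu) (by exact_mod_cast he.const_smul c),
    iteratedFDeriv_const_smul_apply (by exact_mod_cast he)]
  rfl

lemma aux_compare {n k : ℕ} (hk : 1 ≤ k) (Ω : Set (EuclideanSpace ℝ (Fin n)))
    (hΩo : IsOpen Ω) (hΩb : Bornology.IsBounded Ω)
    (θ e : EuclideanSpace ℝ (Fin n) → ℝ) (hθ : KAdmissible n k Ω θ) (he : KAdmissible n k Ω e)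
    (hb : ∀ x ∈ frontier Ω, θ x = 0) (heb : ∀ x ∈ frontier Ω, e x = 0)
    (c : ℝ) (hc : 0 < c) (h : ∀ x ∈ Ω, SkHess n k θ x < c ^ k * SkHess n k e x) :
    ∀ x ∈ closure Ω, c * e x ≤ θ x := by
  intro x hx
  have hcpt : IsCompact (closure Ω) := hΩb.isCompact_closure
  obtain ⟨y, hy, hmin⟩ := hcpt.exists_isMinOn ⟨x, hx⟩
    (f := θ - c • e) (hθ.2.1.sub (he.2.1.const_smul c))
  have hxy : (θ - c • e) y ≤ (θ - c • e) x := hmin hx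
  by_cases hyΩ : y ∈ Ω
  · exfalso
    have hn : Ω ∈ 𝓝 y := hΩo.mem_nhds hyΩ
    have h1 : ContDiffAt ℝ 2 θ y := hθ.1.contDiffAt hn
    have h2 : ContDiffAt ℝ 2 e y := he.1.contDiffAt hn
    have hloc : IsLocalMin (θ - c • e) y :=
      hmin.isLocalMin (mem_of_superset hn subset_closure)
    have hpsd := aux_hess_psd (θ - c • e) y (h1.sub (h2.const_smul c)) hloc
    rw [aux_hess_sub _ _ _ _ h1 h2] at hpsd
    have := aux_mono (hessianMatrix n θ y) (c • hessianMatrix n e y)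
      (by
        have := aux_hess_herm e y h2
        unfold Matrix.IsHermitian at *
        rw [Matrix.conjTranspose_smul, this]; simp) hpsd k hk
      (fun j hj1 hj => by
        rw [aux_smul]; exact mul_pos (pow_pos hc _) (he.2.2 j hj1 hj y hyΩ))
    rw [aux_smul] at this
    exact absurd this (not_le.2 (h y hyΩ))
  · have hyf : y ∈ frontier Ω := by
      rw [frontier, hΩo.interior_eq]; exact ⟨hy, hyΩ⟩
    simp only [Pi.sub_apply, Pi.smul_apply, smul_eq_mul, hb y hyf, heb y hyf] at hxy
    linarith

end Ana

/-- comparison of the solution `θ` of (★) with the `k`-admissible solution `e`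
of `S_k(D²e) = 1`, `e = 0` on `∂Ω`: with `c = (sup_Ω|θ|/(k-1))^{1/k}` one has `θ ≥ c e` on
`Ω̄`, hence `sup_Ω|θ| ≤ c sup_Ω|e|` and `sup_Ω|θ| ≤ (k-1)^{-1/(k-1)} (sup_Ω|e|)^{k/(k-1)}`. -/
theorem stmt_5 (n k : ℕ) (hn : 2 ≤ n) (hk : 2 ≤ k) (hkn : k ≤ n)
    (Ω : Set (EuclideanSpace ℝ (Fin n))) (hΩo : IsOpen Ω) (hΩb : Bornology.IsBounded Ω)
    (θ : EuclideanSpace ℝ (Fin n) → ℝ) (hθ : IsStarSolution n k Ω θ)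
    (e : EuclideanSpace ℝ (Fin n) → ℝ)
    (he_adm : KAdmissible n k Ω e) (he_neg : ∀ x ∈ Ω, e x < 0)
    (he_eq : ∀ x ∈ Ω, SkHess n k e x = 1) (he_bd : ∀ x ∈ frontier Ω, e x = 0) :
    (∀ x ∈ closure Ω,
        (supAbs n Ω θ / ((k : ℝ) - 1)) ^ ((1 : ℝ) / (k : ℝ)) * e x ≤ θ x) ∧
    supAbs n Ω θ ≤
      (supAbs n Ω θ / ((k : ℝ) - 1)) ^ ((1 : ℝ) / (k : ℝ)) * supAbs n Ω e ∧
    supAbs n Ω θ ≤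
      ((k : ℝ) - 1) ^ (-(1 : ℝ) / ((k : ℝ) - 1)) *
        (supAbs n Ω e) ^ ((k : ℝ) / ((k : ℝ) - 1)) := by
  obtain ⟨hθa, hθn, hθb, hθe⟩ := hθ
  have hk1 : (0 : ℝ) < (k : ℝ) - 1 := by
    have : (2 : ℝ) ≤ k := by exact_mod_cast hk
    linarith
  have hk0 : (k : ℝ) ≠ 0 := by linarith
  have hbdd : ∀ u : EuclideanSpace ℝ (Fin n) → ℝ, ContinuousOn u (closure Ω) →
      BddAbove ((fun x => |u x|) '' Ω) := fun u hu =>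
    (hΩb.isCompact_closure.bddAbove_image hu.abs).mono (image_mono subset_closure)
  have hle : ∀ u : EuclideanSpace ℝ (Fin n) → ℝ, ContinuousOn u (closure Ω) →
      ∀ x ∈ Ω, |u x| ≤ supAbs n Ω u := fun u hu x hx =>
    le_csSup (hbdd u hu) (mem_image_of_mem _ hx)
  have hnn : ∀ u : EuclideanSpace ℝ (Fin n) → ℝ, 0 ≤ supAbs n Ω u := fun u =>
    Real.sSup_nonneg (by rintro _ ⟨x, _, rfl⟩; exact abs_nonneg _)
  have hM0 := hnn θ
  have hE0 := hnn e
  have hMle := hle θ hθa.2.1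
  have hEle := hle e he_adm.2.1
  set M := supAbs n Ω θ with hM
  set E := supAbs n Ω e with hE
  set c := (M / ((k : ℝ) - 1)) ^ ((1 : ℝ) / (k : ℝ)) with hc
  have hMk : 0 ≤ M / ((k : ℝ) - 1) := div_nonneg hM0 hk1.le
  have hc0 : 0 ≤ c := Real.rpow_nonneg hMk _
  have hck : c ^ k = M / ((k : ℝ) - 1) := by
    rw [hc, one_div, Real.rpow_inv_natCast_pow hMk (by omega)]
  have part1 : ∀ x ∈ closure Ω, c * e x ≤ θ x := by
    intro x hx
    have hall : ∀ c' ∈ Ioi c, c' * e x ≤ θ x := by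
      intro c' hc'
      have hc'' : c < c' := hc'
      refine aux_compare (by omega) Ω hΩo hΩb θ e hθa he_adm hθb he_bd c' (by linarith) ?_ x hx
      intro y hy
      rw [he_eq y hy, hθe y hy, mul_one]
      calc -θ y / ((k : ℝ) - 1) ≤ M / ((k : ℝ) - 1) := by
            gcongr
            exact (neg_le_abs _).trans (hMle y hy)
        _ = c ^ k := hck.symm
        _ < c' ^ k := pow_lt_pow_left₀ hc'' hc0 (by omega)
    have ht : Tendsto (fun c' : ℝ => c' * e x) (nhdsWithin c (Ioi c)) (nhds (c * e x)) :=
      ((continuous_id.mul continuous_const).tendsto c).mono_left nhdsWithin_le_nhds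
    exact le_of_tendsto ht (eventually_nhdsWithin_of_forall hall)
  have part2 : M ≤ c * E := by
    rw [hM]
    refine Real.sSup_le ?_ (mul_nonneg hc0 hE0)
    rintro _ ⟨x, hx, rfl⟩
    have h1 := part1 x (subset_closure hx)
    have h2 := hEle x hx
    rw [abs_of_neg (he_neg x hx)] at h2
    simp only [abs_of_neg (hθn x hx)]
    nlinarith [mul_le_mul_of_nonneg_left h2 hc0]
  refine ⟨part1, part2, ?_⟩
  rcases hM0.eq_or_lt with h0 | hpos
  · rw [← h0]; positivity
  have hpow : M ^ k ≤ M / ((k : ℝ) - 1) * E ^ k := by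
    rw [← hck, ← mul_pow]; exact pow_le_pow_left₀ hM0 part2 k
  obtain ⟨m, rfl⟩ : ∃ m, k = m + 1 := ⟨k - 1, by omega⟩
  have hm : m ≠ 0 := by omega
  have hkm : ((m + 1 : ℕ) : ℝ) - 1 = m := by push_cast; ring
  rw [hkm] at hpow hk1 ⊢
  have hpow' : M ^ m ≤ (m : ℝ)⁻¹ * E ^ (m + 1) := by
    refine le_of_mul_le_mul_left ?_ hpos
    calc M * M ^ m = M ^ (m + 1) := by ring
      _ ≤ _ := hpow
      _ = _ := by rw [div_eq_mul_inv]; ring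
  calc M = (M ^ m) ^ ((m : ℝ)⁻¹) := (Real.pow_rpow_inv_natCast hM0 hm).symm
    _ ≤ ((m : ℝ)⁻¹ * E ^ (m + 1)) ^ ((m : ℝ)⁻¹) :=
        Real.rpow_le_rpow (by positivity) hpow' (by positivity)
    _ = _ := by
        rw [Real.mul_rpow (by positivity) (by positivity), neg_div, one_div,
          Real.rpow_neg hk1.le, Real.inv_rpow hk1.le, ← Real.rpow_natCast E, ← Real.rpow_mul hE0,
          div_eq_mul_inv]
end
end
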